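/- arXiv:1009.1484 — 3 statements merged into one kernel-verified Lean document; each statement's English description precedes it below -/
import Mathlib

section
/- (Furstenberg correspondence principle.) Let ℓ ∈ ℕ and E ⊂ ℤ^ℓ. There exist a probability space (X, 𝒳, μ), commuting invertible measure preserving transformations T₁, …, T_ℓ : X → X, and a set A ∈ 𝒳 with μ(A) = d*(E), such that for all m ∈ ℕ and all vectors n⃗_j = (n_{1,j}, …, n_{ℓ,j}) ∈ ℤ^ℓ, j = 1, …, m, one has d*(E ∩ (E − n⃗₁) ∩ … ∩ (E − n⃗ₘ)) ≥ μ(A ∩ (∏_{i=1}^ℓ T_i^{n_{i,1}})A ∩ … ∩ (∏_{i=1}^ℓ T_i^{n_{i,m}})A). -/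
open MeasureTheory
open Classical

/-- The upper Banach density of a set `E ⊆ ℤ^ℓ`: the limit, as `L → ∞`, of the supremum of
the densities `|E ∩ I| / |I|` over all parallelepipeds (boxes) `I` all of whose side lengths
are at least `L`. -/
noncomputable def upperBanachDensity {ℓ : ℕ} (E : Set (Fin ℓ → ℤ)) : ℝ :=
  ⨅ L : ℕ, ⨆ (a : Fin ℓ → ℤ) (b : Fin ℓ → ℤ) (_ : ∀ i, a i + L ≤ b i),
    (((Finset.Icc a b).filter fun x => x ∈ E).card : ℝ) / ((Finset.Icc a b).card : ℝ)

/-- `prodPow T n` is the composition `T₁^{n₁} ∘ T₂^{n₂} ∘ ⋯ ∘ T_ℓ^{n_ℓ}` of the integer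
powers of the invertible transformations `T i`. -/
def prodPow {X : Type*} {ℓ : ℕ} (T : Fin ℓ → Equiv.Perm X) (n : Fin ℓ → ℤ) : Equiv.Perm X :=
  (List.ofFn fun i => T i ^ n i).prod

open Filter Topology

namespace Furst

variable {ℓ : ℕ}

noncomputable def dens (S : Set (Fin ℓ → ℤ)) (a b : Fin ℓ → ℤ) : ℝ :=
  (((Finset.Icc a b).filter fun x => x ∈ S).card : ℝ) / ((Finset.Icc a b).card : ℝ)

lemma dens_nonneg (S : Set (Fin ℓ → ℤ)) (a b : Fin ℓ → ℤ) : 0 ≤ dens S a b := by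
  unfold dens; positivity

lemma dens_le_one (S : Set (Fin ℓ → ℤ)) (a b : Fin ℓ → ℤ) : dens S a b ≤ 1 := by
  unfold dens
  apply div_le_one_of_le₀
  · exact_mod_cast Finset.card_filter_le _ _
  · positivity

lemma ubd_eq (S : Set (Fin ℓ → ℤ)) : upperBanachDensity S =
    ⨅ L : ℕ, ⨆ (a : Fin ℓ → ℤ) (b : Fin ℓ → ℤ) (_ : ∀ i, a i + L ≤ b i), dens S a b := rfl

lemma inner_le_one (S : Set (Fin ℓ → ℤ)) (a b : Fin ℓ → ℤ) (P : Prop) :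
    (⨆ (_ : P), dens S a b) ≤ 1 :=
  Real.iSup_le (fun _ => dens_le_one S a b) zero_le_one

lemma dens_le_sup (S : Set (Fin ℓ → ℤ)) (L : ℕ) (a b : Fin ℓ → ℤ) (h : ∀ i, a i + L ≤ b i) :
    dens S a b ≤ ⨆ (a : Fin ℓ → ℤ) (b : Fin ℓ → ℤ) (_ : ∀ i, a i + L ≤ b i), dens S a b := by
  refine le_ciSup_of_le ⟨1, ?_⟩ a (le_ciSup_of_le ⟨1, ?_⟩ b ?_)
  · rintro _ ⟨a, rfl⟩
    exact Real.iSup_le (fun b => inner_le_one S a b _) zero_le_one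
  · rintro _ ⟨b, rfl⟩
    exact inner_le_one S a b _
  · rw [ciSup_pos h]

lemma ubd_le_sup (S : Set (Fin ℓ → ℤ)) (L : ℕ) : upperBanachDensity S ≤
    ⨆ (a : Fin ℓ → ℤ) (b : Fin ℓ → ℤ) (_ : ∀ i, a i + L ≤ b i), dens S a b := by
  rw [ubd_eq]
  refine ciInf_le ⟨0, ?_⟩ L
  rintro _ ⟨L, rfl⟩
  exact Real.iSup_nonneg fun a => Real.iSup_nonneg fun b => Real.iSup_nonneg fun _ =>
    dens_nonneg S a b

lemma exists_box (S : Set (Fin ℓ → ℤ)) (L : ℕ) {ε : ℝ} (hε : 0 < ε) :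
    ∃ a b : Fin ℓ → ℤ, (∀ i, a i + L ≤ b i) ∧ upperBanachDensity S - ε ≤ dens S a b := by
  have h := lt_of_lt_of_le (sub_lt_self _ hε) (ubd_le_sup S L)
  obtain ⟨a, ha⟩ := exists_lt_of_lt_ciSup h
  obtain ⟨b, hb⟩ := exists_lt_of_lt_ciSup ha
  by_cases hP : ∀ i, a i + L ≤ b i
  · rw [ciSup_pos hP] at hb
    exact ⟨a, b, hP, hb.le⟩
  · have : IsEmpty (∀ i, a i + (L : ℤ) ≤ b i) := ⟨hP⟩
    rw [Real.iSup_of_isEmpty] at hb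
    exact ⟨fun _ => 0, fun _ => L, fun i => by simp, hb.le.trans (dens_nonneg _ _ _)⟩

lemma limit_le (S : Set (Fin ℓ → ℤ)) (a b : ℕ → Fin ℓ → ℤ) (h : ∀ k i, a k i + k ≤ b k i)
    (U : Filter ℕ) [U.NeBot] (hU : U ≤ atTop) {r : ℝ}
    (hr : Tendsto (fun k => dens S (a k) (b k)) U (𝓝 r)) : r ≤ upperBanachDensity S := by
  rw [ubd_eq]
  refine le_ciInf fun L => le_of_tendsto hr ?_
  filter_upwards [hU (eventually_ge_atTop L)] with k hk
  refine dens_le_sup S L _ _ fun i => ?_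
  have := h k i
  have : (L : ℤ) ≤ k := by exact_mod_cast hk
  lia

lemma face_card (a b : Fin ℓ → ℤ) (i : Fin ℓ) (hab : a i ≤ b i) :
    ((Finset.Icc (Function.update a i (b i)) b).card : ℝ) * (b i - a i + 1)
      = (Finset.Icc a b).card := by
  rw [Pi.card_Icc, Pi.card_Icc, ← Finset.mul_prod_erase _ _ (Finset.mem_univ i),
    ← Finset.mul_prod_erase _ (fun j => (Finset.Icc (a j) (b j)).card) (Finset.mem_univ i)]
  have : ∏ x ∈ Finset.univ.erase i, (Finset.Icc (Function.update a i (b i) x) (b x)).card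
      = ∏ x ∈ Finset.univ.erase i, (Finset.Icc (a x) (b x)).card := by
    refine Finset.prod_congr rfl fun x hx => ?_
    rw [Function.update_of_ne (Finset.ne_of_mem_erase hx)]
  rw [this]
  have h2 : (((Finset.Icc (a i) (b i)).card : ℕ) : ℝ) = b i - a i + 1 := by
    have : (((Finset.Icc (a i) (b i)).card : ℕ) : ℤ) = b i - a i + 1 := by
      rw [Int.card_Icc]; lia
    exact_mod_cast this
  push_cast
  rw [h2]
  simp
  ring

lemma shift_bound (a b : Fin ℓ → ℤ) (i : Fin ℓ) (hab : a i ≤ b i) (g : (Fin ℓ → ℤ) → ℝ) (C : ℝ)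
    (hg : ∀ x, |g x| ≤ C) :
    |∑ x ∈ Finset.Icc a b, g (x - Pi.single i 1) - ∑ x ∈ Finset.Icc a b, g x| * (b i - a i + 1)
      ≤ 2 * C * (Finset.Icc a b).card := by
  set e : Fin ℓ → ℤ := Pi.single i 1 with he
  set J := (Finset.Icc a b).map (Equiv.subRight e).toEmbedding with hJ
  have h1 : ∑ x ∈ Finset.Icc a b, g (x - e) = ∑ x ∈ J, g x := by
    rw [hJ, Finset.sum_map]; rfl
  have hC : 0 ≤ C := (abs_nonneg _).trans (hg 0)
  have hcard : (J \ Finset.Icc a b).card = (Finset.Icc a b \ J).card :=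
    Finset.card_sdiff_comm (by rw [hJ, Finset.card_map])
  have hsub : (Finset.Icc a b \ J) ⊆ Finset.Icc (Function.update a i (b i)) b := by
    intro x hx
    rw [Finset.mem_sdiff, Finset.mem_Icc] at hx
    obtain ⟨⟨h1, h2⟩, h3⟩ := hx
    rw [Finset.mem_Icc]
    refine ⟨?_, h2⟩
    rw [update_le_iff]
    refine ⟨?_, fun j _ => h1 j⟩
    by_contra hlt
    apply h3
    rw [hJ, Finset.mem_map]
    refine ⟨x + e, ?_, by simp⟩
    rw [Finset.mem_Icc]
    constructor
    · intro j
      have := h1 j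
      by_cases hj : j = i
      · subst hj; simp [he]; lia
      · simp [he, hj]; lia
    · intro j
      have := h2 j
      by_cases hj : j = i
      · subst hj; simp [he]; lia
      · simp [he, hj]; lia
  have hb : ∀ s : Finset (Fin ℓ → ℤ), |∑ x ∈ s, g x| ≤ s.card * C := fun s =>
    (Finset.abs_sum_le_sum_abs _ _).trans ((Finset.sum_le_card_nsmul _ _ C fun x _ => hg x).trans
      (by simp))
  rw [h1, ← Finset.sum_sdiff_sub_sum_sdiff, ← face_card a b i hab]
  have hpos : (0 : ℝ) ≤ b i - a i + 1 := by
    have : (a i : ℝ) ≤ b i := by exact_mod_cast hab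
    linarith
  have hc : ((Finset.Icc a b \ J).card : ℝ) ≤ (Finset.Icc (Function.update a i (b i)) b).card := by
    exact_mod_cast Finset.card_le_card hsub
  rw [← mul_assoc]
  refine mul_le_mul_of_nonneg_right ?_ hpos
  refine (abs_sub _ _).trans ?_
  have e1 := hb (J \ Finset.Icc a b)
  have e2 := hb (Finset.Icc a b \ J)
  rw [hcard] at e1
  have := mul_le_mul_of_nonneg_right hc hC
  linarith

/-- the shift space -/
abbrev X (ℓ : ℕ) : Type := (Fin ℓ → ℤ) → Bool

noncomputable def pt (E : Set (Fin ℓ → ℤ)) (v : Fin ℓ → ℤ) : X ℓ := fun y => decide (y + v ∈ E)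

noncomputable def emp (E : Set (Fin ℓ → ℤ)) (I : Finset (Fin ℓ → ℤ)) : Measure (X ℓ) :=
  (I.card : ENNReal)⁻¹ • ∑ v ∈ I, Measure.dirac (pt E v)

lemma emp_prob (E : Set (Fin ℓ → ℤ)) (I : Finset (Fin ℓ → ℤ)) (hI : I.Nonempty) :
    IsProbabilityMeasure (emp E I) := by
  constructor
  simp only [emp, Measure.smul_apply, Measure.finsetSum_apply, measure_univ, smul_eq_mul]
  simp only [Finset.sum_const, nsmul_eq_mul, mul_one]
  exact ENNReal.inv_mul_cancel (by simpa using hI.ne_empty) (by simp)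

lemma emp_apply (E : Set (Fin ℓ → ℤ)) (a b : Fin ℓ → ℤ) (B : Set (X ℓ)) (hB : MeasurableSet B) :
    (emp E (Finset.Icc a b) B).toReal = dens {v | pt E v ∈ B} a b := by
  simp only [emp, Measure.smul_apply, Measure.finsetSum_apply, smul_eq_mul,
    Measure.dirac_apply' _ hB, dens, ENNReal.toReal_mul, Set.indicator_apply, Pi.one_apply]
  rw [Finset.sum_boole]
  simp only [ENNReal.toReal_inv, ENNReal.toReal_natCast, Set.mem_setOf_eq]
  rw [div_eq_inv_mul]

lemma emp_integral (E : Set (Fin ℓ → ℤ)) (I : Finset (Fin ℓ → ℤ)) (f : X ℓ → ℝ)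
    (hf : Continuous f) :
    ∫ x, f x ∂(emp E I) = (I.card : ℝ)⁻¹ * ∑ v ∈ I, f (pt E v) := by
  rw [emp, integral_smul_measure, integral_finsetSum_measure]
  · simp
  · intro i _
    exact integrable_dirac (by simp)

/-- shift action -/
def shift (ℓ : ℕ) : Multiplicative (Fin ℓ → ℤ) →* Equiv.Perm (X ℓ) where
  toFun n :=
    { toFun := fun ω y => ω (y - n.toAdd)
      invFun := fun ω y => ω (y + n.toAdd)
      left_inv := fun ω => by ext; simp
      right_inv := fun ω => by ext; simp }
  map_one' := by ext; simp
  map_mul' m n := by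
    ext ω y
    simp [sub_sub]

@[simp] lemma shift_apply (n : Multiplicative (Fin ℓ → ℤ)) (ω : X ℓ) (y : Fin ℓ → ℤ) :
    shift ℓ n ω y = ω (y - n.toAdd) := rfl

@[simp] lemma shift_symm_apply (n : Multiplicative (Fin ℓ → ℤ)) (ω : X ℓ) (y : Fin ℓ → ℤ) :
    (shift ℓ n).symm ω y = ω (y + n.toAdd) := rfl

def T (i : Fin ℓ) : Equiv.Perm (X ℓ) := shift ℓ (Multiplicative.ofAdd (Pi.single i 1))

lemma prodPow_T (n : Fin ℓ → ℤ) : prodPow (T (ℓ := ℓ)) n = shift ℓ (Multiplicative.ofAdd n) := by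
  unfold prodPow T
  have : (fun i : Fin ℓ => shift ℓ (Multiplicative.ofAdd (Pi.single i 1)) ^ n i) =
    (shift ℓ) ∘ (fun i => (Multiplicative.ofAdd (Pi.single i (1 : ℤ))) ^ n i) := by
    ext1 i; simp
  rw [this, ← List.map_ofFn, ← map_list_prod, List.prod_ofFn]
  congr 1
  apply Multiplicative.toAdd.injective
  rw [toAdd_prod]
  ext j
  simp [Finset.sum_apply, Pi.single_apply]

lemma T_cont (i : Fin ℓ) : Continuous (T i : X ℓ → X ℓ) :=
  continuous_pi fun y => continuous_apply (y - Pi.single i 1)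

lemma T_symm_cont (i : Fin ℓ) : Continuous ((T i).symm : X ℓ → X ℓ) :=
  continuous_pi fun y => continuous_apply (y + Pi.single i 1)

lemma T_pt (E : Set (Fin ℓ → ℤ)) (i : Fin ℓ) (v : Fin ℓ → ℤ) :
    T i (pt E v) = pt E (v - Pi.single i 1) := by
  ext y
  simp only [T, shift_apply, pt, toAdd_ofAdd]
  congr! 2
  abel

def A (ℓ : ℕ) : Set (X ℓ) := {ω | ω 0 = true}

lemma A_clopen : IsClopen (A ℓ) :=
  (isClopen_discrete ({true} : Set Bool)).preimage (continuous_apply (0 : Fin ℓ → ℤ))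

lemma image_A (n : Fin ℓ → ℤ) : ⇑(prodPow (T (ℓ := ℓ)) n) '' (A ℓ) = {ω | ω n = true} := by
  rw [prodPow_T, Equiv.image_eq_preimage_symm]
  ext ω
  simp [A]

lemma image_clopen (n : Fin ℓ → ℤ) : IsClopen (⇑(prodPow (T (ℓ := ℓ)) n) '' (A ℓ)) := by
  rw [image_A]
  exact (isClopen_discrete ({true} : Set Bool)).preimage (continuous_apply n)

lemma map_eq (E : Set (Fin ℓ → ℤ)) (a b : ℕ → Fin ℓ → ℤ) (h : ∀ k i, a k i + k ≤ b k i)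
    (U : Filter ℕ) [U.NeBot] (hU : U ≤ atTop) (ν : ℕ → ProbabilityMeasure (X ℓ))
    (hν : ∀ k, (ν k : Measure (X ℓ)) = emp E (Finset.Icc (a k) (b k)))
    (μ : ProbabilityMeasure (X ℓ)) (hμ : Tendsto ν U (𝓝 μ)) (i : Fin ℓ) :
    Measure.map (T i) (μ : Measure (X ℓ)) = μ := by
  have : IsProbabilityMeasure (Measure.map (T i) (μ : Measure (X ℓ))) :=
    Measure.isProbabilityMeasure_map (T_cont i).aemeasurable
  refine ext_of_forall_integral_eq_of_IsFiniteMeasure fun f => ?_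
  rw [integral_map (T_cont i).aemeasurable f.continuous.aestronglyMeasurable]
  rw [ProbabilityMeasure.tendsto_iff_forall_integral_tendsto] at hμ
  have h1 := hμ f
  have h2 := hμ (f.compContinuous ⟨T i, T_cont i⟩)
  refine tendsto_nhds_unique h2 ?_
  have h3 : Tendsto (fun k => ∫ x, (f.compContinuous ⟨T i, T_cont i⟩) x ∂(ν k : Measure (X ℓ))
      - ∫ x, f x ∂(ν k : Measure (X ℓ))) U (𝓝 0) := by
    refine squeeze_zero_norm (a := fun k : ℕ => 2 * ‖f‖ * (1 / ((k : ℝ) + 1))) (fun k => ?_) ?_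
    · rw [hν, emp_integral _ _ _ f.continuous, emp_integral _ _ _ (by fun_prop)]
      have hk : ∀ j, a k j ≤ b k j := fun j => by have := h k j; lia
      have hb := shift_bound (a k) (b k) i (hk i) (fun v => f (pt E v)) ‖f‖
        (fun x => f.norm_coe_le_norm _)
      have hne : (Finset.Icc (a k) (b k)).Nonempty := Finset.nonempty_Icc.2 hk
      have hc : (0 : ℝ) < (Finset.Icc (a k) (b k)).card := by exact_mod_cast hne.card_pos
      have hs : (k : ℝ) + 1 ≤ b k i - a k i + 1 := by
        have : (a k i : ℝ) + k ≤ b k i := by exact_mod_cast h k i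
        linarith
      simp only [BoundedContinuousFunction.compContinuous_apply, ContinuousMap.coe_mk, T_pt]
      rw [← mul_sub, Real.norm_eq_abs, abs_mul, abs_inv, abs_of_pos hc, mul_one_div,
        inv_mul_le_iff₀ hc, mul_div_assoc', le_div_iff₀ (by positivity)]
      refine (mul_le_mul_of_nonneg_left hs (abs_nonneg _)).trans (hb.trans (le_of_eq (by ring)))
    · have := (tendsto_one_div_add_atTop_nhds_zero_nat (𝕜 := ℝ)).const_mul (2 * ‖f‖)
      rw [mul_zero] at this
      exact this.mono_left hU
  have h4 := h3.add h1
  simpa using h4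

end Furst

open Furst in
/-- Furstenberg correspondence principle: for every `E ⊆ ℤ^ℓ` there are a probability space
`(X, 𝒳, μ)`, commuting invertible measure preserving transformations `T₁, …, T_ℓ` of `X`,
and a set `A ∈ 𝒳` with `μ(A) = d*(E)` such that
`d*(E ∩ (E − n⃗₁) ∩ … ∩ (E − n⃗ₘ)) ≥ μ(A ∩ (∏ᵢ Tᵢ^{n_{i,1}})A ∩ … ∩ (∏ᵢ Tᵢ^{n_{i,m}})A)`
for all `m` and all `n⃗₁, …, n⃗ₘ ∈ ℤ^ℓ`. -/
theorem furstenberg_correspondence (ℓ : ℕ) (E : Set (Fin ℓ → ℤ)) :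
    ∃ (X : Type) (mX : MeasurableSpace X) (μ : @Measure X mX)
      (T : Fin ℓ → Equiv.Perm X) (A : Set X),
      @IsProbabilityMeasure X mX μ ∧
      (∀ i, @MeasurePreserving X X mX mX (T i) μ μ) ∧
      (∀ i, @MeasurePreserving X X mX mX (T i).symm μ μ) ∧
      (∀ i i', Commute (T i) (T i')) ∧
      @MeasurableSet X mX A ∧
      (μ A).toReal = upperBanachDensity E ∧
      ∀ (m : ℕ) (n : Fin m → Fin ℓ → ℤ),
        (μ (A ∩ ⋂ j : Fin m, ⇑(prodPow T (n j)) '' A)).toReal ≤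
          upperBanachDensity (E ∩ ⋂ j : Fin m, {x | x + n j ∈ E}) := by
  have hbox := fun k : ℕ => exists_box E k (ε := 1 / ((k : ℝ) + 1)) (by positivity)
  choose a b hab hd using hbox
  let ν : ℕ → ProbabilityMeasure (Furst.X ℓ) := fun k =>
    ⟨emp E (Finset.Icc (a k) (b k)), emp_prob E _ (Finset.nonempty_Icc.2 fun j => by
      have := hab k j; lia)⟩
  have hν : ∀ k, (ν k : Measure (Furst.X ℓ)) = emp E (Finset.Icc (a k) (b k)) := fun k => rfl
  let U : Ultrafilter ℕ := Ultrafilter.of atTop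
  have hU : (U : Filter ℕ) ≤ atTop := Ultrafilter.of_le _
  obtain ⟨μ, -, hμ⟩ := (isCompact_univ (X := ProbabilityMeasure (Furst.X ℓ))).ultrafilter_le_nhds
    (U.map ν) (by simp)
  have hμ : Tendsto ν U (𝓝 μ) := hμ
  have hclopen : ∀ B : Set (Furst.X ℓ), IsClopen B →
      Tendsto (fun k => dens {v | pt E v ∈ B} (a k) (b k)) U
        (𝓝 ((μ : Measure (Furst.X ℓ)) B).toReal) := by
    intro B hB
    have := ProbabilityMeasure.tendsto_measure_of_null_frontier_of_tendsto' hμ (E := B)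
      (by simp [hB.frontier_eq])
    have := (ENNReal.tendsto_toReal (measure_ne_top _ _)).comp this
    refine this.congr fun k => ?_
    rw [Function.comp_apply, hν, emp_apply _ _ _ _ hB.isOpen.measurableSet]
  have hinv := map_eq E a b hab U hU ν hν μ hμ
  have hT : ∀ i, MeasurePreserving (Furst.T i) (μ : Measure (Furst.X ℓ)) μ := fun i =>
    ⟨(T_cont i).measurable, hinv i⟩
  have hA : {v | pt E v ∈ Furst.A ℓ} = E := by
    ext v; simp [Furst.A, pt]
  refine ⟨Furst.X ℓ, inferInstance, μ, Furst.T, Furst.A ℓ, inferInstance, hT, fun i => ?_,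
    fun i i' => ?_, A_clopen.isOpen.measurableSet, ?_, fun m n => ?_⟩
  · exact (hT i).symm (⟨Furst.T i, (T_cont i).measurable, (T_symm_cont i).measurable⟩ :
      Furst.X ℓ ≃ᵐ Furst.X ℓ)
  · exact (Commute.all _ _).map (shift ℓ)
  · have h1 := hclopen _ A_clopen
    rw [hA] at h1
    refine le_antisymm (limit_le E a b hab U hU h1) ?_
    have h2 := (tendsto_one_div_add_atTop_nhds_zero_nat (𝕜 := ℝ)).mono_left hU
    have h3 := h2.const_sub (upperBanachDensity E)
    rw [sub_zero] at h3
    exact le_of_tendsto_of_tendsto' h3 h1 hd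
  · have h1 := hclopen _ (A_clopen.inter (isClopen_iInter_of_finite fun j => image_clopen (n j)))
    refine limit_le _ a b hab U hU ?_
    convert h1 using 3
    ext v
    simp only [image_A]
    simp [Furst.A, pt, add_comm]
end

section
/- If a : ℕ → ℂ is a bounded sequence, then |(1/π(N)) Σ_{p ∈ ℙ, p ≤ N} a(p) − (1/N) Σ_{n=1}^N Λ'(n)·a(n)| → 0 as N → ∞. -/
/-- The modified von Mangoldt function `Λ'`, equal to `log n` when `n` is prime
and to `0` otherwise (i.e. `Λ'(n) = 1_ℙ(n)·Λ(n)`). -/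
noncomputable def LambdaPrime (n : ℕ) : ℝ := if n.Prime then Real.log n else 0

open MeasureTheory Filter Topology Set

/-- Fejer kernel. -/
noncomputable def fk (w : ℝ) : ℝ := 2 * (1 - Real.cos w) / w ^ 2

lemma fk_nonneg (w : ℝ) : 0 ≤ fk w := by
  unfold fk
  have := Real.cos_le_one w
  apply div_nonneg <;> nlinarith [sq_nonneg w]

lemma fk_le (w : ℝ) : fk w ≤ 5 * (1 + w ^ 2)⁻¹ := by
  unfold fk
  rcases eq_or_ne w 0 with rfl | hw
  · simp
  have h2 : 0 < w ^ 2 := by positivity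
  have h3 := Real.neg_one_le_cos w
  have h4 := Real.one_sub_sq_div_two_le_cos (x := w)
  rw [← div_eq_mul_inv, div_le_div_iff₀ h2 (by positivity)]
  nlinarith

lemma fk_meas : Measurable fk := by
  unfold fk; fun_prop

lemma fk_integrable : Integrable fk := by
  refine (integrable_inv_one_add_sq.const_mul 5).mono' fk_meas.aestronglyMeasurable ?_
  filter_upwards with w
  rw [Real.norm_of_nonneg (fk_nonneg w)]
  exact fk_le w

lemma fk_integral_pos : 0 < ∫ w, fk w := by
  rw [integral_pos_iff_support_of_nonneg fk_nonneg fk_integrable]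
  have : Ioo (0:ℝ) 1 ⊆ Function.support fk := by
    intro w hw
    have h1 : Real.cos w < 1 := by
      have := Real.cos_lt_cos_of_nonneg_of_le_pi (x := 0) (y := w) le_rfl
        (by linarith [hw.2, Real.pi_gt_three]) hw.1
      simpa using this
    simp only [Function.mem_support, fk]
    have := hw.1
    apply ne_of_gt
    apply div_pos <;> [linarith; positivity]
  refine lt_of_lt_of_le ?_ (measure_mono this)
  simp

lemma fk_half (z : ℂ) (hz : z ≠ 0) :
    ∫ t in (0:ℝ)..1, ((1 - t : ℝ) : ℂ) * Complex.exp (t * z) = (Complex.exp z - 1 - z) / z ^ 2 := by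
  have h : ∀ t ∈ uIcc (0:ℝ) 1, HasDerivAt (fun t : ℝ => (1 - t : ℂ) * Complex.exp (t * z) / z
      + Complex.exp (t * z) / z ^ 2) (((1 - t : ℝ) : ℂ) * Complex.exp (t * z)) t := by
    intro t _
    have h1 : HasDerivAt (fun t : ℝ => (t : ℂ)) 1 t := Complex.ofRealCLM.hasDerivAt
    have h2 := (h1.mul_const z).cexp
    have h3 := (((h1.const_sub 1).mul h2).div_const z).add (h2.div_const (z ^ 2))
    refine h3.congr_deriv ?_
    push_cast
    field_simp
    ring
  rw [intervalIntegral.integral_eq_sub_of_hasDerivAt h]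
  · push_cast
    simp
    field_simp
    ring
  · apply Continuous.intervalIntegrable; fun_prop

lemma fk_eq (w : ℝ) (hw : w ≠ 0) :
    ∫ t in (-1:ℝ)..1, ((1 - |t| : ℝ) : ℂ) * Complex.exp (t * (w * Complex.I)) = fk w := by
  have hc : Continuous (fun t : ℝ => ((1 - |t| : ℝ) : ℂ) * Complex.exp (t * (w * Complex.I))) := by
    fun_prop
  rw [← intervalIntegral.integral_add_adjacent_intervals (b := 0) (hc.intervalIntegrable _ _)
    (hc.intervalIntegrable _ _)]
  have e1 : ∫ t in (-1:ℝ)..0, ((1 - |t| : ℝ) : ℂ) * Complex.exp (t * (w * Complex.I)) =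
      ∫ t in (0:ℝ)..1, ((1 - t : ℝ) : ℂ) * Complex.exp (t * (-(w * Complex.I))) := by
    have := intervalIntegral.integral_comp_neg (a := 0) (b := 1)
      (fun t : ℝ => ((1 - |t| : ℝ) : ℂ) * Complex.exp (t * (w * Complex.I)))
    rw [neg_zero] at this
    rw [← this]
    apply intervalIntegral.integral_congr
    intro t ht
    rw [uIcc_of_le zero_le_one] at ht
    simp [abs_of_nonneg ht.1]
  have e2 : ∫ t in (0:ℝ)..1, ((1 - |t| : ℝ) : ℂ) * Complex.exp (t * (w * Complex.I)) =
      ∫ t in (0:ℝ)..1, ((1 - t : ℝ) : ℂ) * Complex.exp (t * ((w * Complex.I))) := by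
    apply intervalIntegral.integral_congr
    intro t ht
    rw [uIcc_of_le zero_le_one] at ht
    simp [abs_of_nonneg ht.1]
  have hwc : (w : ℂ) ≠ 0 := by exact_mod_cast hw
  have hz : (w : ℂ) * Complex.I ≠ 0 := by simp [hw]
  rw [e1, e2, fk_half _ hz, fk_half _ (neg_ne_zero.mpr hz), fk]
  push_cast
  rw [Complex.cos, neg_mul]
  rw [neg_sq, mul_pow, Complex.I_sq]
  field_simp
  ring

lemma fubini_step (D : ℝ → ℝ) (hD : Measurable D) (M : ℝ) (hM : ∀ u, |D u| ≤ M)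
    (G : ℂ → ℂ)
    (hL : ∀ ε : ℝ, 0 < ε → ∀ t : ℝ, ∫ u in Ioi (0:ℝ), (D u : ℂ) *
      Complex.exp (-(ε + t * Complex.I) * u) = G (1 + ε + t * Complex.I))
    (L : ℝ) (hLpos : 0 < L) (v ε : ℝ) (hε : 0 < ε) :
    ∫ t in (-1:ℝ)..1, ((1 - |t| : ℝ) : ℂ) * Complex.exp (t * ((L * v : ℝ) * Complex.I)) *
      G (1 + ε + (L * t : ℝ) * Complex.I) =
    ∫ u in Ioi (0:ℝ), ((D u * Real.exp (-(ε * u)) * fk (L * (v - u)) : ℝ) : ℂ) := by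
  have hM0 : 0 ≤ M := (abs_nonneg _).trans (hM 0)
  have hint : Integrable (fun u => D u * Real.exp (-(ε * u))) (volume.restrict (Ioi (0:ℝ))) := by
    have h1 : IntegrableOn (fun u : ℝ => Real.exp (-ε * u)) (Ioi 0) :=
      exp_neg_integrableOn_Ioi 0 hε
    refine (h1.const_mul M).mono' (by fun_prop) ?_
    filter_upwards with u
    rw [norm_mul, Real.norm_eq_abs, Real.norm_of_nonneg (Real.exp_pos _).le, neg_mul]
    gcongr
    exact hM u
  have hone : Integrable (fun _ : ℝ => (1:ℝ)) (volume.restrict (Ioc (-1:ℝ) 1)) := by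
    simp
  have hprod := hone.mul_prod hint
  have hP : Integrable (Function.uncurry fun (t u : ℝ) =>
      ((1 - |t| : ℝ) : ℂ) * Complex.exp (t * ((L * (v - u) : ℝ) * Complex.I)) *
        ((D u * Real.exp (-(ε * u)) : ℝ) : ℂ))
      ((volume.restrict (Ioc (-1:ℝ) 1)).prod (volume.restrict (Ioi (0:ℝ)))) := by
    refine hprod.mono ?_ ?_
    · apply Measurable.aestronglyMeasurable
      unfold Function.uncurry
      fun_prop
    · rw [Measure.prod_restrict]
      filter_upwards [ae_restrict_mem (measurableSet_Ioc.prod measurableSet_Ioi)] with p hp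
      obtain ⟨t, u⟩ := p
      simp only [Function.uncurry]
      rw [norm_mul, norm_mul, Complex.norm_real, Complex.norm_real, one_mul]
      have e : (t : ℂ) * ((L * (v - u) : ℝ) * Complex.I) = (t * (L * (v - u)) : ℝ) * Complex.I := by
        push_cast; ring
      rw [e, Complex.norm_exp_ofReal_mul_I, mul_one]
      apply mul_le_of_le_one_left (norm_nonneg _)
      have ht : t ∈ Ioc (-1:ℝ) 1 := hp.1
      have : |t| ≤ 1 := abs_le.mpr ⟨ht.1.le, ht.2⟩
      rw [Real.norm_eq_abs, abs_le]
      constructor <;> linarith [abs_nonneg t]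
  have hsw := integral_integral_swap hP
  rw [intervalIntegral.integral_of_le (by norm_num)]
  refine Eq.trans ?_ (hsw.trans ?_)
  · apply integral_congr_ae
    filter_upwards with t
    have := hL ε hε (L * t)
    rw [← this, ← integral_const_mul]
    apply integral_congr_ae
    filter_upwards with u
    have e : Complex.exp (-(ε + (L * t : ℝ) * Complex.I) * u) =
      Complex.exp ((-(ε * u) : ℝ)) * Complex.exp (t * ((L * (- u) : ℝ) * Complex.I)) := by
      rw [← Complex.exp_add]; congr 1; push_cast; ring
    have e' : Complex.exp (t * ((L * (v - u) : ℝ) * Complex.I)) =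
      Complex.exp (t * ((L * v : ℝ) * Complex.I)) * Complex.exp (t * ((L * (- u) : ℝ) * Complex.I)) := by
      rw [← Complex.exp_add]; congr 1; push_cast; ring
    rw [e, e']
    push_cast
    ring
  · apply integral_congr_ae
    have : ∀ᵐ u ∂(volume.restrict (Ioi (0:ℝ))), u ≠ v := by
      apply ae_restrict_of_ae
      exact (measure_eq_zero_iff_ae_notMem (s := {v})).mp (by simp)
    filter_upwards [this] with u hu
    rw [integral_mul_const, ← intervalIntegral.integral_of_le (by norm_num), fk_eq]
    · push_cast; ring
    · exact mul_ne_zero hLpos.ne' (sub_ne_zero.mpr hu.symm)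

lemma limit_step (D : ℝ → ℝ) (hD : Measurable D) (M : ℝ) (hM : ∀ u, |D u| ≤ M)
    (G : ℂ → ℂ) (hG : ContinuousOn G {s | 1 ≤ s.re})
    (hL : ∀ ε : ℝ, 0 < ε → ∀ t : ℝ, ∫ u in Ioi (0:ℝ), (D u : ℂ) *
      Complex.exp (-(ε + t * Complex.I) * u) = G (1 + ε + t * Complex.I))
    (L : ℝ) (hLpos : 0 < L) (v : ℝ) :
    ∫ t in (-1:ℝ)..1, ((1 - |t| : ℝ) : ℂ) * Complex.exp (t * ((L * v : ℝ) * Complex.I)) *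
      G (1 + (L * t : ℝ) * Complex.I) =
    ∫ u in Ioi (0:ℝ), ((D u * fk (L * (v - u)) : ℝ) : ℂ) := by
  have hM0 : 0 ≤ M := (abs_nonneg _).trans (hM 0)
  have hG2 : ContinuousOn (fun p : ℝ × ℝ => G (1 + p.1 + (L * p.2 : ℝ) * Complex.I))
      (Icc 0 1 ×ˢ Icc (-1) 1) := by
    refine hG.comp (by fun_prop) ?_
    intro p hp
    have := hp.1.1
    simpa using this
  obtain ⟨C, hC⟩ := (isCompact_Icc.prod isCompact_Icc).exists_bound_of_continuousOn hG2
  have hev : ∀ᶠ ε : ℝ in 𝓝[>] 0, ε ∈ Ioc (0:ℝ) 1 := Ioc_mem_nhdsGT one_pos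
  have h1 : Tendsto (fun ε : ℝ => ∫ t in (-1:ℝ)..1, ((1 - |t| : ℝ) : ℂ) *
      Complex.exp (t * ((L * v : ℝ) * Complex.I)) * G (1 + ε + (L * t : ℝ) * Complex.I))
      (𝓝[>] 0) (𝓝 (∫ t in (-1:ℝ)..1, ((1 - |t| : ℝ) : ℂ) *
      Complex.exp (t * ((L * v : ℝ) * Complex.I)) * G (1 + (L * t : ℝ) * Complex.I))) := by
    refine intervalIntegral.tendsto_integral_filter_of_dominated_convergence (fun _ => C) ?_ ?_ ?_ ?_
    · filter_upwards [hev] with ε hε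
      rw [uIoc_of_le (by norm_num)]
      apply ContinuousOn.aestronglyMeasurable _ measurableSet_Ioc
      refine ContinuousOn.mul (by fun_prop) ?_
      refine hG.comp (by fun_prop) ?_
      intro t ht
      simpa using hε.1.le
    · filter_upwards [hev] with ε hε
      filter_upwards with t ht
      rw [uIoc_of_le (by norm_num)] at ht
      have e : (t : ℂ) * ((L * v : ℝ) * Complex.I) = (t * (L * v) : ℝ) * Complex.I := by
        push_cast; ring
      rw [norm_mul, norm_mul, e, Complex.norm_exp_ofReal_mul_I, mul_one, Complex.norm_real]
      have h3 := hC (ε, t) ⟨⟨hε.1.le, hε.2⟩, ⟨ht.1.le, ht.2⟩⟩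
      refine le_trans ?_ h3
      apply mul_le_of_le_one_left (norm_nonneg _)
      have : |t| ≤ 1 := abs_le.mpr ⟨ht.1.le, ht.2⟩
      rw [Real.norm_eq_abs, abs_le]
      constructor <;> linarith [abs_nonneg t]
    · simp
    · filter_upwards with t ht
      apply Tendsto.const_mul
      have h4 : ContinuousWithinAt G {s | 1 ≤ s.re} (1 + (L * t : ℝ) * Complex.I) :=
        hG _ (by simp)
      refine h4.tendsto.comp (tendsto_nhdsWithin_iff.mpr ⟨?_, ?_⟩)
      · have : Continuous (fun ε : ℝ => (1 + ε + (L * t : ℝ) * Complex.I : ℂ)) := by fun_prop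
        have := (this.tendsto 0).mono_left (nhdsWithin_le_nhds (s := Ioi 0))
        simpa using this
      · filter_upwards [hev] with ε hε
        simpa using hε.1.le
  have hfi : Integrable (fun u => fk (L * (v - u))) :=
    (fk_integrable.comp_mul_left' hLpos.ne').comp_sub_left v
  have h2 : Tendsto (fun ε : ℝ => ∫ u in Ioi (0:ℝ),
      ((D u * Real.exp (-(ε * u)) * fk (L * (v - u)) : ℝ) : ℂ)) (𝓝[>] 0)
      (𝓝 (∫ u in Ioi (0:ℝ), ((D u * fk (L * (v - u)) : ℝ) : ℂ))) := by
    have hfm := fk_meas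
    refine tendsto_integral_filter_of_dominated_convergence
      (fun u => M * fk (L * (v - u))) ?_ ?_ (hfi.const_mul M).integrableOn ?_
    · filter_upwards with ε
      apply Measurable.aestronglyMeasurable
      fun_prop
    · filter_upwards [hev] with ε hε
      filter_upwards [ae_restrict_mem measurableSet_Ioi] with u hu
      rw [Complex.norm_real, norm_mul, norm_mul, Real.norm_of_nonneg (fk_nonneg _),
        Real.norm_of_nonneg (Real.exp_pos _).le, Real.norm_eq_abs]
      apply mul_le_mul_of_nonneg_right _ (fk_nonneg _)
      have h5 : Real.exp (-(ε * u)) ≤ 1 := by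
        rw [Real.exp_le_one_iff]
        have : 0 ≤ ε * u := mul_nonneg hε.1.le (le_of_lt hu)
        linarith
      calc |D u| * Real.exp (-(ε * u)) ≤ M * 1 := by
            apply mul_le_mul (hM u) h5 (Real.exp_pos _).le hM0
        _ = M := mul_one M
    · filter_upwards with u
      have : Continuous (fun ε : ℝ => ((D u * Real.exp (-(ε * u)) * fk (L * (v - u)) : ℝ) : ℂ)) := by
        fun_prop
      have := (this.tendsto 0).mono_left (nhdsWithin_le_nhds (s := Ioi 0))
      simpa using this
  refine tendsto_nhds_unique h1 (h2.congr' ?_)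
  filter_upwards [self_mem_nhdsWithin] with ε hε
  exact (fubini_step D hD M hM G hL L hLpos v ε hε).symm

lemma smoothed (D : ℝ → ℝ) (hD : Measurable D) (M : ℝ) (hM : ∀ u, |D u| ≤ M)
    (G : ℂ → ℂ) (hG : ContinuousOn G {s | 1 ≤ s.re})
    (hL : ∀ ε : ℝ, 0 < ε → ∀ t : ℝ, ∫ u in Ioi (0:ℝ), (D u : ℂ) *
      Complex.exp (-(ε + t * Complex.I) * u) = G (1 + ε + t * Complex.I))
    (L : ℝ) (hLpos : 0 < L) :
    Tendsto (fun v : ℝ => ∫ u in Ioi (0:ℝ), D u * fk (L * (v - u))) atTop (𝓝 0) := by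
  have key := Real.tendsto_integral_exp_smul_cocompact (fun t : ℝ => (Ioc (-1:ℝ) 1).indicator
    (fun t : ℝ => ((1 - |t| : ℝ) : ℂ) * G (1 + (L * t : ℝ) * Complex.I)) t)
  have hmap : Tendsto (fun v : ℝ => -(L * v / (2 * Real.pi))) atTop (cocompact ℝ) := by
    refine Tendsto.mono_right ?_ atBot_le_cocompact
    refine tendsto_neg_atTop_atBot.comp ?_
    exact (tendsto_id.const_mul_atTop hLpos).atTop_div_const (by positivity)
  have h2 := (key.comp hmap).norm
  rw [norm_zero] at h2
  rw [tendsto_zero_iff_norm_tendsto_zero]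
  refine h2.congr fun v => ?_
  rw [← Complex.norm_real, ← integral_complex_ofReal, ← limit_step D hD M hM G hG hL L hLpos v]
  congr 1
  rw [intervalIntegral.integral_of_le (by norm_num), ← integral_indicator measurableSet_Ioc]
  simp only [Function.comp]
  apply integral_congr_ae
  filter_upwards with t
  by_cases ht : t ∈ Ioc (-1:ℝ) 1
  · rw [indicator_of_mem ht, indicator_of_mem ht, Circle.smul_def, Real.fourierChar_apply]
    have : (2 * Real.pi * -(t * -(L * v / (2 * Real.pi))) : ℝ) = t * (L * v) := by
      field_simp
    rw [this, smul_eq_mul]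
    push_cast
    rw [mul_assoc (t : ℂ)]
    ring
  · rw [indicator_of_notMem ht, indicator_of_notMem ht, smul_zero]

theorem tauber (B : ℝ → ℝ) (hB : Measurable B) (M : ℝ) (hB0 : ∀ u, 0 ≤ B u) (hBM : ∀ u, B u ≤ M)
    (hmono : Monotone (fun u => B u * Real.exp u))
    (G : ℂ → ℂ) (hG : ContinuousOn G {s | 1 ≤ s.re})
    (hL : ∀ ε : ℝ, 0 < ε → ∀ t : ℝ, ∫ u in Ioi (0:ℝ), ((B u - 1 : ℝ) : ℂ) *
      Complex.exp (-(ε + t * Complex.I) * u) = G (1 + ε + t * Complex.I)) :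
    Tendsto B atTop (𝓝 1) := by
  have hM0 : 0 ≤ M := (hB0 0).trans (hBM 0)
  have hD : Measurable (fun u => B u - 1) := by fun_prop
  have hDM : ∀ u, |B u - 1| ≤ M + 1 := by
    intro u
    rw [abs_le]
    constructor <;> linarith [hB0 u, hBM u]
  have hfm := fk_meas
  set c := ∫ w, fk w with hc
  have hcpos : 0 < c := fk_integral_pos
  -- extended function
  set B0 : ℝ → ℝ := fun u => if 0 < u then B u else 1 with hB0def
  have hB0m : Measurable B0 := Measurable.ite measurableSet_Ioi hB measurable_const
  have hB0nn : ∀ u, 0 ≤ B0 u := by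
    intro u; simp only [hB0def]; split_ifs <;> [exact hB0 u; norm_num]
  have hB0M : ∀ u, B0 u ≤ M + 1 := by
    intro u; simp only [hB0def]; split_ifs <;> linarith [hBM u]
  have hint : ∀ L v : ℝ, Integrable (fun w => B0 (v - w / L) * fk w) := by
    intro L v
    refine (fk_integrable.const_mul (M + 1)).mono' (by fun_prop) ?_
    filter_upwards with w
    rw [norm_mul, Real.norm_of_nonneg (fk_nonneg _), Real.norm_of_nonneg (hB0nn _)]
    exact mul_le_mul_of_nonneg_right (hB0M _) (fk_nonneg _)
  have hS : ∀ L : ℝ, 0 < L → Tendsto (fun v : ℝ => ∫ w, B0 (v - w / L) * fk w) atTop (𝓝 c) := by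
    intro L hLpos
    have h1 := (smoothed _ hD (M + 1) hDM G hG hL L hLpos).const_mul L
    rw [mul_zero] at h1
    have h2 := h1.add_const c
    rw [zero_add] at h2
    refine h2.congr fun v => ?_
    have e1 : ∫ u in Ioi (0:ℝ), (B u - 1) * fk (L * (v - u)) =
        ∫ u, (B0 u - 1) * fk (L * (v - u)) := by
      rw [← integral_indicator measurableSet_Ioi]
      congr 1
      ext u
      by_cases hu : 0 < u
      · rw [indicator_of_mem (show u ∈ Ioi (0:ℝ) from hu)]; simp [hB0def, hu]
      · rw [indicator_of_notMem (show u ∉ Ioi (0:ℝ) from hu)]; simp [hB0def, hu]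
    have e2 : ∫ u, (B0 u - 1) * fk (L * (v - u)) =
        ∫ u, (B0 (v - u) - 1) * fk (L * u) := by
      rw [← integral_sub_left_eq_self _ volume v]
      simp
    have e3 : ∫ u, (B0 (v - u) - 1) * fk (L * u) =
        L⁻¹ * ∫ w, (B0 (v - w / L) - 1) * fk w := by
      have := Measure.integral_comp_mul_left (fun w => (B0 (v - w / L) - 1) * fk w) L
      rw [abs_of_pos (inv_pos.mpr hLpos), smul_eq_mul] at this
      rw [← this]
      congr 1
      ext u
      rw [mul_div_cancel_left₀ _ hLpos.ne']
    have e4 : ∫ w, (B0 (v - w / L) - 1) * fk w = (∫ w, B0 (v - w / L) * fk w) - c := by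
      rw [hc, ← integral_sub (hint L v) fk_integrable]
      congr 1
      ext w
      ring
    rw [e1, e2, e3, e4]
    field_simp
    ring
  -- main bound
  have main : ∀ η : ℝ, 0 < η → η < 1 → η < c → ∀ᶠ v in atTop,
      |c * (B v - 1)| ≤ η * (2 + 2 * c + 2 * M + 2 * c * M) := by
    intro η hη hη1 hηc
    obtain ⟨R, hR, hRc⟩ : ∃ R : ℝ, 0 < R ∧ c - η ≤ ∫ w in Icc (-R) R, fk w := by
      have h1 := intervalIntegral_tendsto_integral fk_integrable tendsto_neg_atTop_atBot tendsto_id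
      have h2 := h1.eventually (lt_mem_nhds (show c - η < ∫ w, fk w by linarith))
      obtain ⟨R, h3, h4⟩ := (h2.and (eventually_gt_atTop 0)).exists
      refine ⟨R, h4, ?_⟩
      rw [integral_Icc_eq_integral_Ioc, ← intervalIntegral.integral_of_le (by linarith)]
      exact h3.le
    have hRle : ∫ w in Icc (-R) R, fk w ≤ c :=
      setIntegral_le_integral fk_integrable (ae_of_all _ fk_nonneg)
    have hcompl : ∫ w in (Icc (-R) R)ᶜ, fk w ≤ η := by
      have := integral_add_compl (measurableSet_Icc (a := -R) (b := R)) fk_integrable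
      linarith
    set L := R / η with hLdef
    have hLpos : 0 < L := by positivity
    have hw : ∀ w ∈ Icc (-R) R, |w / L| ≤ η := by
      intro w hw
      rw [abs_div, abs_of_pos hLpos, div_le_iff₀ hLpos, hLdef, mul_div_cancel₀ _ hη.ne']
      exact abs_le.mpr hw
    have hexp : 1 - 2 * η ≤ Real.exp (-(2 * η)) := by
      linarith [Real.add_one_le_exp (-(2 * η))]
    have hexp1 : Real.exp (-(2 * η)) ≤ 1 := by
      rw [Real.exp_le_one_iff]; linarith
    have cmp : ∀ x y : ℝ, x ≤ y → y ≤ x + 2 * η → B x * Real.exp (-(2 * η)) ≤ B y := by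
      intro x y hxy hyx
      have h1 : B x * Real.exp x ≤ B y * Real.exp y := hmono hxy
      have h2 : Real.exp x * Real.exp (-y) = Real.exp (x - y) := by
        rw [← Real.exp_add]; ring_nf
      have h3 : Real.exp y * Real.exp (-y) = 1 := by
        rw [← Real.exp_add]; simp
      have h4 : B x * Real.exp (x - y) ≤ B y := by
        calc B x * Real.exp (x - y) = (B x * Real.exp x) * Real.exp (-y) := by rw [← h2]; ring
          _ ≤ (B y * Real.exp y) * Real.exp (-y) := by gcongr
          _ = B y := by rw [mul_assoc, h3, mul_one]
      refine le_trans ?_ h4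
      apply mul_le_mul_of_nonneg_left _ (hB0 x)
      apply Real.exp_le_exp.mpr
      linarith
    have hnear : ∀ᶠ v in atTop, |(∫ w, B0 (v - w / L) * fk w) - c| < η := by
      have := (hS L hLpos).eventually (Metric.ball_mem_nhds c hη)
      simpa [Real.dist_eq] using this
    have hup := (tendsto_atTop_add_const_right atTop η tendsto_id).eventually hnear
    have hdn := (tendsto_atTop_add_const_right atTop (-η) tendsto_id).eventually hnear
    filter_upwards [hup, hdn, eventually_gt_atTop 2] with v hv1 hv2 hv3
    simp only [id] at hv1 hv2
    rw [abs_lt] at hv1 hv2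
    have up : B v * Real.exp (-(2 * η)) * (c - η) ≤ c + η := by
      calc B v * Real.exp (-(2 * η)) * (c - η)
          ≤ B v * Real.exp (-(2 * η)) * ∫ w in Icc (-R) R, fk w :=
            mul_le_mul_of_nonneg_left hRc (mul_nonneg (hB0 v) (Real.exp_pos _).le)
        _ = ∫ w in Icc (-R) R, B v * Real.exp (-(2 * η)) * fk w := by rw [integral_const_mul]
        _ ≤ ∫ w in Icc (-R) R, B0 (v + η - w / L) * fk w := by
            apply setIntegral_mono_on (fk_integrable.const_mul _).integrableOn
              (hint L (v + η)).integrableOn measurableSet_Icc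
            intro w hwm
            have h5 := abs_le.mp (hw w hwm)
            have : B0 (v + η - w / L) = B (v + η - w / L) := by
              simp only [hB0def]; rw [if_pos]; linarith
            rw [this]
            exact mul_le_mul_of_nonneg_right (cmp _ _ (by linarith) (by linarith)) (fk_nonneg _)
        _ ≤ ∫ w, B0 (v + η - w / L) * fk w :=
            setIntegral_le_integral (hint L (v + η))
              (ae_of_all _ fun w => mul_nonneg (hB0nn _) (fk_nonneg _))
        _ ≤ c + η := by linarith
    have dn : Real.exp (-(2 * η)) * (c - η - (M + 1) * η) ≤ B v * c := by
      have h6 : Real.exp (-(2 * η)) * ∫ w in Icc (-R) R, B0 (v + -η - w / L) * fk w ≤ B v * c := by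
        calc Real.exp (-(2 * η)) * ∫ w in Icc (-R) R, B0 (v + -η - w / L) * fk w
            = ∫ w in Icc (-R) R, Real.exp (-(2 * η)) * (B0 (v + -η - w / L) * fk w) := by
              rw [integral_const_mul]
          _ ≤ ∫ w in Icc (-R) R, B v * fk w := by
              apply setIntegral_mono_on ((hint L (v + -η)).const_mul _).integrableOn
                (fk_integrable.const_mul _).integrableOn measurableSet_Icc
              intro w hwm
              have h5 := abs_le.mp (hw w hwm)
              have : B0 (v + -η - w / L) = B (v + -η - w / L) := by
                simp only [hB0def]; rw [if_pos]; linarith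
              rw [this, ← mul_assoc, mul_comm (Real.exp _)]
              exact mul_le_mul_of_nonneg_right (cmp _ _ (by linarith) (by linarith)) (fk_nonneg _)
          _ = B v * ∫ w in Icc (-R) R, fk w := by rw [integral_const_mul]
          _ ≤ B v * c := mul_le_mul_of_nonneg_left hRle (hB0 v)
      have h7 : ∫ w in (Icc (-R) R)ᶜ, B0 (v + -η - w / L) * fk w ≤ (M + 1) * η := by
        calc _ ≤ ∫ w in (Icc (-R) R)ᶜ, (M + 1) * fk w := by
              apply setIntegral_mono (hint L (v + -η)).integrableOn
                (fk_integrable.const_mul _).integrableOn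
              intro w
              exact mul_le_mul_of_nonneg_right (hB0M _) (fk_nonneg _)
          _ = (M + 1) * ∫ w in (Icc (-R) R)ᶜ, fk w := by rw [integral_const_mul]
          _ ≤ (M + 1) * η := mul_le_mul_of_nonneg_left hcompl (by linarith)
      have h8 := integral_add_compl (measurableSet_Icc (a := -R) (b := R)) (hint L (v + -η))
      refine le_trans (mul_le_mul_of_nonneg_left ?_ (Real.exp_pos _).le) h6
      linarith
    set E := Real.exp (-(2 * η)) with hE
    have hEp : 0 < E := Real.exp_pos _
    have hb := hB0 v
    have hbM := hBM v
    rw [abs_le]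
    constructor
    · have h9 : E * (c - η - (M + 1) * η) ≥ c - 2 * η * c - (M + 2) * η := by
        have : E * ((M + 2) * η) ≤ 1 * ((M + 2) * η) := by gcongr
        have : (1 - 2 * η) * c ≤ E * c := by gcongr
        nlinarith
      nlinarith [mul_nonneg hM0 hη.le, mul_nonneg (mul_nonneg hcpos.le hM0) hη.le]
    · have h9 : B v * (1 - 2 * η) * c ≤ B v * E * c := by gcongr
      have h10 : B v * E * η ≤ M * 1 * η := by gcongr
      have h11 : B v * (2 * η * c) ≤ M * (2 * η * c) := by gcongr
      nlinarith [mul_nonneg hM0 hη.le, mul_nonneg hcpos.le hη.le]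
  rw [Metric.tendsto_nhds]
  intro e he
  set K := 2 + 2 * c + 2 * M + 2 * c * M with hK
  have hKpos : 0 < K := by positivity
  have hη : 0 < min (1 / 2) (min (c / 2) (e * c / (2 * K))) := by positivity
  have hm := main _ hη (lt_of_le_of_lt (min_le_left _ _) (by norm_num))
    (lt_of_le_of_lt ((min_le_right _ _).trans (min_le_left _ _)) (by linarith))
  filter_upwards [hm] with v hv
  have h1 : min (1 / 2) (min (c / 2) (e * c / (2 * K))) * K ≤ e * c / (2 * K) * K := by
    gcongr
    exact (min_le_right _ _).trans (min_le_right _ _)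
  have h2 : e * c / (2 * K) * K = e * c / 2 := by field_simp
  rw [abs_mul, abs_of_pos hcpos] at hv
  rw [Real.dist_eq]
  have h3 : 0 < e * c := by positivity
  have h4 : c * |B v - 1| < c * e := by linarith
  exact lt_of_mul_lt_mul_left h4 hcpos.le

lemma psi_bigO : (fun n : ℕ => ∑ k ∈ Finset.Icc 1 n, ArithmeticFunction.vonMangoldt k) =O[atTop]
    fun n : ℕ => (n : ℝ) ^ (1 : ℝ) := by
  refine Asymptotics.IsBigO.of_bound (Real.log 4 + 4) ?_
  filter_upwards with n
  have h1 := Chebyshev.psi_le_const_mul_self (x := n) (Nat.cast_nonneg n)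
  have h2 := Chebyshev.psi_nonneg n
  rw [Chebyshev.psi, Nat.floor_natCast] at h1 h2
  have e : Finset.Ioc 0 n = Finset.Icc 1 n := rfl
  rw [e] at h1 h2
  rw [Real.rpow_one, Real.norm_of_nonneg h2, Real.norm_of_nonneg (Nat.cast_nonneg n)]
  exact h1

lemma laplace (s : ℂ) (hs : 1 < s.re) :
    ∫ u in Ioi (0:ℝ), ((Chebyshev.psi (Real.exp u) * Real.exp (-u) - 1 : ℝ) : ℂ) *
      Complex.exp (-(s - 1) * u) =
    LSeries (fun n => (ArithmeticFunction.vonMangoldt n : ℂ)) s / s - 1 / (s - 1) := by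
  have hs0 : s ≠ 0 := by rintro rfl; simp at hs; linarith
  have hre : (-(s - 1)).re < 0 := by simp; linarith
  have hs1 : s - 1 ≠ 0 := by
    intro h; rw [h] at hre; simp at hre
  have h1 := LSeries_eq_mul_integral_of_nonneg (fun n => ArithmeticFunction.vonMangoldt n)
    zero_le_one hs psi_bigO (fun n => ArithmeticFunction.vonMangoldt_nonneg)
  have e1 : ∫ u in Ioi (0:ℝ), Real.exp u • ((fun t : ℝ => (∑ k ∈ Finset.Icc 1 ⌊t⌋₊,
      (ArithmeticFunction.vonMangoldt k : ℂ)) * (t : ℂ) ^ (-(s + 1))) (Real.exp u)) =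
      ∫ t in Ioi (1 : ℝ), (∑ k ∈ Finset.Icc 1 ⌊t⌋₊, (ArithmeticFunction.vonMangoldt k : ℂ)) *
        (t : ℂ) ^ (-(s + 1)) := by
    have himg : Real.exp '' (Ioi 0) = Ioi 1 := by
      ext x
      constructor
      · rintro ⟨u, hu, rfl⟩
        exact Real.one_lt_exp_iff.mpr hu
      · intro hx
        exact ⟨Real.log x, Real.log_pos hx, Real.exp_log (zero_lt_one.trans hx)⟩
    rw [← himg, integral_image_eq_integral_abs_deriv_smul measurableSet_Ioi
      (fun x _ => (Real.hasDerivAt_exp x).hasDerivWithinAt) Real.exp_injective.injOn]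
    simp only [abs_of_pos (Real.exp_pos _)]
  have e2 : ∫ u in Ioi (0:ℝ), Real.exp u • ((fun t : ℝ => (∑ k ∈ Finset.Icc 1 ⌊t⌋₊,
      (ArithmeticFunction.vonMangoldt k : ℂ)) * (t : ℂ) ^ (-(s + 1))) (Real.exp u)) =
      ∫ u in Ioi (0:ℝ), ((Chebyshev.psi (Real.exp u) * Real.exp (-u) : ℝ) : ℂ) *
      Complex.exp (-(s - 1) * u) := by
    apply integral_congr_ae
    filter_upwards with u
    have e : (∑ k ∈ Finset.Icc 1 ⌊Real.exp u⌋₊, (ArithmeticFunction.vonMangoldt k : ℂ)) =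
      ((Chebyshev.psi (Real.exp u) : ℝ) : ℂ) := by
      rw [Chebyshev.psi]; push_cast; rfl
    simp only [e]
    have hx : ((Real.exp u : ℝ) : ℂ) ≠ 0 := by exact_mod_cast (Real.exp_pos u).ne'
    rw [Complex.cpow_def_of_ne_zero hx, ← Complex.ofReal_log (Real.exp_pos u).le, Real.log_exp,
      Complex.real_smul]
    push_cast
    have : Complex.exp (u * -(s + 1)) * Complex.exp u =
      Complex.exp (-u) * Complex.exp (-(s - 1) * u) := by
      rw [← Complex.exp_add, ← Complex.exp_add]; congr 1; ring
    linear_combination (Chebyshev.psi (Real.exp u) : ℂ) * this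
  have i2 : IntegrableOn (fun u : ℝ => Complex.exp (-(s - 1) * u)) (Ioi 0) :=
    integrableOn_exp_mul_complex_Ioi hre 0
  have i1 : IntegrableOn (fun u : ℝ => ((Chebyshev.psi (Real.exp u) * Real.exp (-u) : ℝ) : ℂ) *
      Complex.exp (-(s - 1) * u)) (Ioi 0) := by
    have hm : Measurable Chebyshev.psi := Chebyshev.psi_mono.measurable
    refine Integrable.bdd_mul (c := Real.log 4 + 4) i2 (by fun_prop) ?_
    filter_upwards with u
    rw [Complex.norm_real, Real.norm_of_nonneg
      (mul_nonneg (Chebyshev.psi_nonneg _) (Real.exp_pos _).le), Real.exp_neg,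
      ← div_eq_mul_inv, div_le_iff₀ (Real.exp_pos _)]
    exact Chebyshev.psi_le_const_mul_self (Real.exp_pos _).le
  have e3 : ∫ u in Ioi (0:ℝ), Complex.exp (-(s - 1) * u) = 1 / (s - 1) := by
    rw [integral_exp_mul_complex_Ioi hre, Complex.ofReal_zero, mul_zero, Complex.exp_zero,
      neg_div_neg_eq]
  rw [h1, ← e1, e2, mul_div_cancel_left₀ _ hs0, ← e3, ← integral_sub i1 i2]
  congr 1
  ext u
  push_cast
  ring

theorem psi_tendsto : Tendsto (fun u => Chebyshev.psi (Real.exp u) * Real.exp (-u)) atTop (𝓝 1) := by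
  have hm : Measurable Chebyshev.psi := Chebyshev.psi_mono.measurable
  have h1u : IsUnit (1 : ZMod 1) := isUnit_one
  refine tauber _ (by fun_prop) (Real.log 4 + 4)
    (fun u => mul_nonneg (Chebyshev.psi_nonneg _) (Real.exp_pos _).le) ?_ ?_
    (fun s => (ArithmeticFunction.vonMangoldt.LFunctionResidueClassAux (1 : ZMod 1) s - 1) / s) ?_ ?_
  · intro u
    rw [Real.exp_neg, ← div_eq_mul_inv, div_le_iff₀ (Real.exp_pos _)]
    exact Chebyshev.psi_le_const_mul_self (Real.exp_pos _).le
  · intro u v huv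
    simp only [mul_assoc, ← Real.exp_add, neg_add_cancel, Real.exp_zero, mul_one]
    exact Chebyshev.psi_mono (Real.exp_le_exp.mpr huv)
  · refine ContinuousOn.div ((ArithmeticFunction.vonMangoldt.continuousOn_LFunctionResidueClassAux
      (1 : ZMod 1)).sub continuousOn_const) continuousOn_id ?_
    rintro s hs rfl
    simp at hs
    linarith
  · intro ε hε t
    have hs : 1 < (1 + ε + t * Complex.I : ℂ).re := by simpa using hε
    have h := laplace (1 + ε + t * Complex.I) hs
    have e : ∀ u : ℝ, -((1 + ε + t * Complex.I : ℂ) - 1) * u = -(ε + t * Complex.I) * u := by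
      intro u; ring
    simp only [e] at h
    rw [h]
    set s : ℂ := 1 + ε + t * Complex.I
    have hs0 : s ≠ 0 := by intro h; rw [h] at hs; simp at hs; linarith
    have hs1 : s - 1 ≠ 0 := by
      intro h; rw [sub_eq_zero.mp h] at hs; simp at hs
    have h2 := ArithmeticFunction.vonMangoldt.eqOn_LFunctionResidueClassAux h1u hs
    have e2 : (fun n => (ArithmeticFunction.vonMangoldt.residueClass (1 : ZMod 1) n : ℂ)) =
      (fun n => (ArithmeticFunction.vonMangoldt n : ℂ)) := by
      ext n
      simp [ArithmeticFunction.vonMangoldt.residueClass, Subsingleton.elim (n : ZMod 1) 1]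
    simp only [e2] at h2
    rw [h2]
    simp
    field_simp
    ring

theorem psi_div : Tendsto (fun x => Chebyshev.psi x / x) atTop (𝓝 1) := by
  refine (psi_tendsto.comp Real.tendsto_log_atTop).congr' ?_
  filter_upwards [eventually_gt_atTop 0] with x hx
  simp only [Function.comp]
  rw [Real.exp_neg, Real.exp_log hx, div_eq_mul_inv]

theorem theta_div : Tendsto (fun N : ℕ => Chebyshev.theta N / N) atTop (𝓝 1) := by
  have h : Tendsto (fun x => Chebyshev.theta x / x) atTop (𝓝 1) := by
    have h1 : (fun x => Chebyshev.psi x - Chebyshev.theta x) =o[atTop] (fun x : ℝ => x) := by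
      refine Chebyshev.isBigO_psi_sub_theta_sqrt.trans_isLittleO ?_
      rw [Asymptotics.isLittleO_iff_tendsto']
      · refine (Real.tendsto_sqrt_atTop.inv_tendsto_atTop).congr' ?_
        filter_upwards [eventually_gt_atTop 0] with x hx
        simp only [Pi.inv_apply]
        rw [Real.sqrt_div_self', one_div]
      · filter_upwards [eventually_gt_atTop 0] with x hx h
        exact absurd h hx.ne'
    have h2 := psi_div.sub h1.tendsto_div_nhds_zero
    rw [sub_zero] at h2
    refine h2.congr fun x => ?_
    ring
  exact h.comp tendsto_natCast_atTop_atTop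

theorem pi_div : Tendsto (fun N : ℕ => (Nat.primeCounting N : ℝ) * Real.log N / N) atTop (𝓝 1) := by
  have h1 := Chebyshev.primeCounting_sub_theta_div_log_isBigO.comp_tendsto
    (tendsto_natCast_atTop_atTop (R := ℝ))
  obtain ⟨C, hC⟩ := h1.bound
  have h2 : Tendsto (fun N : ℕ => (Nat.primeCounting N : ℝ) * Real.log N / N -
      Chebyshev.theta N / N) atTop (𝓝 0) := by
    have h3 : Tendsto (fun N : ℕ => C * (Real.log N)⁻¹) atTop (𝓝 0) := by
      have := (Real.tendsto_log_atTop.comp (tendsto_natCast_atTop_atTop (R := ℝ))).inv_tendsto_atTop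
      simpa using this.const_mul C
    refine squeeze_zero_norm' ?_ h3
    filter_upwards [hC, eventually_gt_atTop 1] with N hN hN1
    have hN0 : (0:ℝ) < N := by exact_mod_cast (by omega : 0 < N)
    have hl : 0 < Real.log N := Real.log_pos (by exact_mod_cast hN1)
    simp only [Function.comp, Nat.floor_natCast] at hN
    rw [Real.norm_of_nonneg (show (0:ℝ) ≤ N / Real.log N ^ 2 by positivity)] at hN
    have e : (Nat.primeCounting N : ℝ) * Real.log N / N - Chebyshev.theta N / N =
      (Nat.primeCounting N - Chebyshev.theta N / Real.log N) * (Real.log N / N) := by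
      field_simp
    rw [e, norm_mul, Real.norm_of_nonneg (show 0 ≤ Real.log N / N by positivity)]
    calc _ ≤ C * (N / Real.log N ^ 2) * (Real.log N / N) := by gcongr
      _ = C * (Real.log N)⁻¹ := by field_simp
  have h4 := h2.add theta_div
  rw [zero_add] at h4
  refine h4.congr fun N => ?_
  ring

/-- Averages of a bounded sequence over the primes are asymptotically equal to the
`Λ'`-weighted averages over the integers:
`|(1/π(N)) ∑_{p ∈ ℙ, p ≤ N} a(p) − (1/N) ∑_{n=1}^N Λ'(n)·a(n)| → 0` as `N → ∞`. -/
theorem prime_average_eq_weighted_average (a : ℕ → ℂ) (ha : ∃ C : ℝ, ∀ n, ‖a n‖ ≤ C) :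
    Filter.Tendsto (fun N : ℕ =>
      ‖(Nat.primeCounting N : ℂ)⁻¹ * ∑ p ∈ (Finset.Icc 1 N).filter Nat.Prime, a p
        - (N : ℂ)⁻¹ * ∑ n ∈ Finset.Icc 1 N, (LambdaPrime n : ℂ) * a n‖)
      Filter.atTop (nhds 0) := by
  obtain ⟨C, hC⟩ := ha
  have hlim : Tendsto (fun N : ℕ => C * |1 - (Nat.primeCounting N : ℝ) * Real.log N / N| +
      C * ((Nat.primeCounting N : ℝ) * Real.log N / N - Chebyshev.theta N / N)) atTop (𝓝 0) := by
    have h1 := ((pi_div.const_sub 1).abs.const_mul C).add ((pi_div.sub theta_div).const_mul C)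
    simpa using h1
  refine squeeze_zero_norm' ?_ hlim
  filter_upwards [eventually_gt_atTop 1] with N hN1
  rw [norm_norm]
  have hN0 : (0:ℝ) < N := by exact_mod_cast (by omega : 0 < N)
  have hl : 0 < Real.log N := Real.log_pos (by exact_mod_cast hN1)
  set P := (Finset.Icc 1 N).filter Nat.Prime with hP
  have hcard : P.card = Nat.primeCounting N := by
    rw [← Nat.primesLE_card_eq_primeCounting]
    congr 1
    ext p
    simp only [hP, Finset.mem_filter, Finset.mem_Icc, Nat.mem_primesLE]
    constructor
    · rintro ⟨⟨_, h⟩, h'⟩; exact ⟨h, h'⟩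
    · rintro ⟨h, h'⟩; exact ⟨⟨h'.one_lt.le, h⟩, h'⟩
  have hpi : 0 < Nat.primeCounting N := by
    rw [← hcard, Finset.card_pos]
    exact ⟨2, by simp [hP, Nat.prime_two]; omega⟩
  have hpi' : (0:ℝ) < Nat.primeCounting N := by exact_mod_cast hpi
  have htheta : Chebyshev.theta N = ∑ p ∈ P, Real.log p := by
    rw [Chebyshev.theta, Nat.floor_natCast]; rfl
  have hsum : ∑ n ∈ Finset.Icc 1 N, (LambdaPrime n : ℂ) * a n =
      ∑ p ∈ P, ((Real.log p : ℝ) : ℂ) * a p := by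
    rw [hP, Finset.sum_filter]
    apply Finset.sum_congr rfl
    intro n _
    unfold LambdaPrime
    split_ifs <;> simp
  set q : ℝ := (Nat.primeCounting N : ℝ) with hq
  have key : (Nat.primeCounting N : ℂ)⁻¹ * ∑ p ∈ P, a p -
      (N : ℂ)⁻¹ * ∑ p ∈ P, ((Real.log p : ℝ) : ℂ) * a p =
      ∑ p ∈ P, (((q⁻¹ - Real.log N / N : ℝ) : ℂ) * a p +
        (((Real.log N - Real.log p) / N : ℝ) : ℂ) * a p) := by
    rw [Finset.mul_sum, Finset.mul_sum, ← Finset.sum_sub_distrib]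
    apply Finset.sum_congr rfl
    intro p _
    rw [hq]
    push_cast
    ring
  rw [hsum, key]
  calc _ ≤ ∑ p ∈ P, (|q⁻¹ - Real.log N / N| * C + (Real.log N - Real.log p) / N * C) := by
        apply norm_sum_le_of_le
        intro p hp
        refine (norm_add_le _ _).trans ?_
        rw [norm_mul, norm_mul, Complex.norm_real, Complex.norm_real, Real.norm_eq_abs]
        have hp' := Finset.mem_filter.mp hp
        have hpN := Finset.mem_Icc.mp hp'.1
        have : Real.log p ≤ Real.log N :=
          Real.log_le_log (by exact_mod_cast hpN.1) (by exact_mod_cast hpN.2)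
        have h0 : 0 ≤ (Real.log N - Real.log p) / N := div_nonneg (by linarith) hN0.le
        rw [Real.norm_of_nonneg h0]
        gcongr <;> exact hC p
    _ = C * |1 - q * Real.log N / N| + C * (q * Real.log N / N - Chebyshev.theta N / N) := by
        rw [Finset.sum_add_distrib, Finset.sum_const, ← Finset.sum_mul, ← Finset.sum_div,
          Finset.sum_sub_distrib, Finset.sum_const, ← htheta, hcard, nsmul_eq_mul, nsmul_eq_mul,
          ← hq]
        have : |1 - q * Real.log N / N| = q * |q⁻¹ - Real.log N / N| := by
          rw [← abs_of_pos hpi', ← abs_mul, abs_of_pos hpi']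
          congr 1
          field_simp
        rw [this]
        ring
end

section
/- Let ℓ, m ∈ ℕ, (X, 𝒳, μ) be a probability space, T₁, …, T_ℓ : X → X commuting invertible measure preserving transformations, f₁, …, fₘ ∈ L^∞(μ) functions bounded by 1, and q_{i,j} : ℤ → ℤ polynomials for i = 1, …, ℓ, j = 1, …, m. Then there exist d ∈ ℕ, depending only on the maximum degree of the polynomials q_{i,j} and on ℓ and m, and a constant C > 0 depending only on d, such that: for every sequence a : ℕ → ℂ with a(n)/n^c → 0 for every c > 0, and every ε > 0, there is N₀ (depending only on d, a, and ε) so that for all N ≥ N₀, ‖(1/N) Σ_{n=1}^N a(n)·(∏_{i=1}^ℓ T_i^{q_{i,1}(n)})f₁ ⋯ (∏_{i=1}^ℓ T_i^{q_{i,m}(n)})fₘ‖_{L²(μ)} ≤ C·‖a·1_{[1,N]}‖_{U_d(ℤ_{dN})} + ε, where a·1_{[1,N]} is viewed as a function on ℤ_{dN} by identifying ℤ_{dN} with {1, …, dN}. -/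
open MeasureTheory

/-- The Gowers uniformity norm `‖a‖_{U_d(ℤ_N)}` of a function `a : ℤ_N → ℂ` (the cyclic group
`ℤ_N` being realized as `Fin N` with its modular addition), defined inductively by
`‖a‖_{U_1} = |𝔼_n a(n)|` and
`‖a‖_{U_{d+1}} = (𝔼_h ‖a_h · ā‖_{U_d}^{2^d})^{1/2^{d+1}}` where `a_h(n) = a(n+h)`. -/
noncomputable def gowersNorm (N : ℕ) : ℕ → (Fin N → ℂ) → ℝ
  | 0, _ => 0
  | 1, a => ‖(∑ n, a n) / (N : ℂ)‖
  | d + 2, a =>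
      ((∑ h, gowersNorm N (d + 1)
          (fun n => a (n + h) * (starRingEnd ℂ) (a n)) ^ 2 ^ (d + 1)) / (N : ℝ))
        ^ ((1 : ℝ) / 2 ^ (d + 2))

namespace GW

def PD {G : Type} [AddCommGroup G] : ℕ → (ℤ → G) → Prop
  | 0, p => ∀ m n, p m = p n
  | k + 1, p => ∀ h, PD k (fun n => p (n + h) - p n)

section PDsec
variable {G : Type} [AddCommGroup G]

lemma PD.sub {k : ℕ} : ∀ {p q : ℤ → G}, PD k p → PD k q → PD k (fun n => p n - q n) := by
  induction k with
  | zero => intro p q hp hq m n; simp only [hp m n, hq m n]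
  | succ k ih =>
    intro p q hp hq h
    have := ih (hp h) (hq h)
    convert this using 2
    exact sub_sub_sub_comm _ _ _ _

lemma PD.zero (k : ℕ) : PD k (fun _ : ℤ => (0 : G)) := by
  induction k with
  | zero => intro m n; rfl
  | succ k ih => intro h; simpa using ih

lemma PD.add {k : ℕ} {p q : ℤ → G} (hp : PD k p) (hq : PD k q) : PD k (fun n => p n + q n) := by
  have := hp.sub ((PD.zero k).sub hq)
  simpa using this

lemma PD.succ {k : ℕ} : ∀ {p : ℤ → G}, PD k p → PD (k + 1) p := by
  induction k with
  | zero => intro p hp h m n; simp only [hp (m + h) m, hp (n + h) n, sub_self]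
  | succ k ih => intro p hp h; exact ih (hp h)

lemma PD.mono {k l : ℕ} (hkl : k ≤ l) {p : ℤ → G} (hp : PD k p) : PD l p := by
  induction hkl with
  | refl => exact hp
  | step _ ih => exact ih.succ

lemma PD.shift {k : ℕ} (t : ℤ) : ∀ {p : ℤ → G}, PD k p → PD k (fun n => p (n + t)) := by
  induction k with
  | zero => intro p hp m n; exact hp _ _
  | succ k ih =>
    intro p hp h
    have := ih (hp h)
    convert this using 4
    ring

lemma PD.cover {k : ℕ} {g c : ℤ → G} (hg : PD k (fun n => g n - c n)) (hc : PD (k + 1) c) (h : ℤ) :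
    PD k (fun n => g (n + h) - c n) := by
  have h1 : PD (k + 1) g := by
    have := hg.succ.add hc
    simpa using this
  have := (h1 h).add hg
  simpa using this

lemma PD.pi {ι : Type} {k : ℕ} : ∀ {p : ℤ → ι → ℤ}, (∀ i, PD k (fun n => p n i)) → PD k p := by
  induction k with
  | zero => intro p hp m n; funext i; exact hp i m n
  | succ k ih => intro p hp h; exact ih (fun i => hp i h)

lemma PD.poly {k : ℕ} : ∀ {q : Polynomial ℤ}, q.natDegree ≤ k → PD k (fun n => q.eval n) := by
  induction k with
  | zero =>
    intro q hq m n
    rw [Polynomial.eq_C_of_natDegree_le_zero hq]; simp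
  | succ k ih =>
    intro q hq h
    have : (Polynomial.taylor h q - q).natDegree ≤ k := by
      rw [Polynomial.natDegree_le_iff_coeff_eq_zero]
      intro i hi
      rw [Polynomial.coeff_sub]
      rcases eq_or_lt_of_le (Nat.succ_le_of_lt hi) with h1 | h1
      · rcases eq_or_lt_of_le hq with h2 | h2
        · have h3 : i = q.natDegree := by omega
          rw [h3, Polynomial.coeff_taylor_natDegree]; simp
        · rw [Polynomial.coeff_eq_zero_of_natDegree_lt (by rw [Polynomial.natDegree_taylor]; omega),
            Polynomial.coeff_eq_zero_of_natDegree_lt (by omega)]; simp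
      · rw [Polynomial.coeff_eq_zero_of_natDegree_lt (by rw [Polynomial.natDegree_taylor]; omega),
            Polynomial.coeff_eq_zero_of_natDegree_lt (by omega)]; simp
    have := ih this
    simpa [Polynomial.taylor_eval] using this
end PDsec

lemma gowersNorm_nonneg (M d : ℕ) (a : Fin M → ℂ) : 0 ≤ gowersNorm M d a := by
  match d with
  | 0 => simp [gowersNorm]
  | 1 => simp only [gowersNorm]; positivity
  | d + 2 =>
    simp only [gowersNorm]
    apply Real.rpow_nonneg
    apply div_nonneg _ (Nat.cast_nonneg _)
    exact Finset.sum_nonneg fun h _ => (Even.pow_nonneg (by simp [Nat.even_pow]) _)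

lemma gowersNorm_pow (M d : ℕ) (a : Fin M → ℂ) :
    gowersNorm M (d + 2) a ^ 2 ^ (d + 2) = (∑ h, gowersNorm M (d + 1)
          (fun n => a (n + h) * (starRingEnd ℂ) (a n)) ^ 2 ^ (d + 1)) / (M : ℝ) := by
  rw [gowersNorm]
  set y := (∑ h, gowersNorm M (d + 1)
          (fun n => a (n + h) * (starRingEnd ℂ) (a n)) ^ 2 ^ (d + 1)) / (M : ℝ) with hy
  have hy0 : 0 ≤ y := div_nonneg (Finset.sum_nonneg fun h _ =>
    (pow_nonneg (gowersNorm_nonneg _ _ _) _)) (Nat.cast_nonneg _)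
  have := Real.rpow_inv_natCast_pow hy0 (n := 2 ^ (d + 2)) (by positivity)
  simpa using this

section main
variable {G : Type} [AddCommGroup G]

noncomputable def Avg {X ι : Type} [Fintype ι] {M : ℕ} (S : G → X → X) (a : Fin M → ℂ)
    (f : ι → X → ℂ) (g : ι → ℤ → G) (x : X) : ℂ :=
  (∑ k : Fin M, a k * ∏ j, f j (S (g j ((k : ℕ) : ℤ)) x)) / (M : ℂ)

noncomputable def AA {X ι : Type} [Fintype ι] [MeasurableSpace X] (μ : Measure X) {M : ℕ}
    (S : G → X → X) (a : Fin M → ℂ)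
    (f : ι → X → ℂ) (g : ι → ℤ → G) : ℝ :=
  √(∫ x, ‖Avg S a f g x‖ ^ 2 ∂μ)

def Bd (d : ℕ) {ι : Type} [Fintype ι] (g : ι → ℤ → G) : Prop :=
  ∀ (X : Type) [MeasurableSpace X] (μ : Measure X) [IsProbabilityMeasure μ] (S : G → X → X),
    (∀ u v x, S (u + v) x = S u (S v x)) → (∀ u, MeasurePreserving (S u) μ μ) →
    ∀ f : ι → X → ℂ, (∀ j, Measurable (f j)) → (∀ j x, ‖f j x‖ ≤ 1) →
    ∀ N M : ℕ, 2 * N ≤ M → 0 < M → ∀ a : Fin M → ℂ, (∀ k : Fin M, N ≤ (k : ℕ) → a k = 0) →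
    AA μ S a f g ≤ gowersNorm M d a

lemma Avg_meas {X ι : Type} [Fintype ι] [MeasurableSpace X] {M : ℕ}
    {S : G → X → X} (hS : ∀ u, Measurable (S u)) (a : Fin M → ℂ)
    {f : ι → X → ℂ} (hf : ∀ j, Measurable (f j)) (g : ι → ℤ → G) : Measurable (Avg S a f g) := by
  unfold Avg
  refine Measurable.div_const (Finset.measurable_sum _ fun k _ => Measurable.const_mul ?_ _) _
  exact Finset.measurable_prod _ fun j _ => (hf j).comp (hS _)

lemma prod_le {X ι : Type} [Fintype ι] {f : ι → X → ℂ} (hb : ∀ j x, ‖f j x‖ ≤ 1) (y : ι → X) :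
    ‖∏ j, f j (y j)‖ ≤ 1 := by
  rw [norm_prod]
  exact Finset.prod_le_one (fun _ _ => norm_nonneg _) (fun j _ => hb j _)

lemma Avg_bdd {X ι : Type} [Fintype ι] {M : ℕ}
    (S : G → X → X) (a : Fin M → ℂ)
    {f : ι → X → ℂ} (hb : ∀ j x, ‖f j x‖ ≤ 1) (g : ι → ℤ → G) (x : X) :
    ‖Avg S a f g x‖ ≤ (∑ k, ‖a k‖) / M := by
  unfold Avg
  rw [norm_div, Complex.norm_natCast]
  gcongr
  refine (norm_sum_le _ _).trans (Finset.sum_le_sum fun k _ => ?_)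
  rw [norm_mul]
  exact mul_le_of_le_one_right (norm_nonneg _) (prod_le hb _)

lemma integrable_sq {X : Type} [MeasurableSpace X] (μ : Measure X) [IsProbabilityMeasure μ]
    {F : X → ℂ} (hF : Measurable F) {B : ℝ} (hB : ∀ x, ‖F x‖ ≤ B) :
    Integrable (fun x => ‖F x‖ ^ 2) μ := by
  refine Integrable.of_bound (by fun_prop) (B ^ 2) (Filter.Eventually.of_forall fun x => ?_)
  rw [Real.norm_of_nonneg (by positivity)]
  exact pow_le_pow_left₀ (norm_nonneg _) (hB x) 2

lemma norm_integral_le_sqrt {X : Type} [MeasurableSpace X] (μ : Measure X) [IsProbabilityMeasure μ]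
    {F : X → ℂ} (hF : Measurable F) {B : ℝ} (hB : ∀ x, ‖F x‖ ≤ B) :
    ‖∫ x, F x ∂μ‖ ≤ √(∫ x, ‖F x‖ ^ 2 ∂μ) := by
  refine (norm_integral_le_integral_norm _).trans (Real.le_sqrt_of_sq_le ?_)
  have h1 : Integrable (fun x => ‖F x‖) μ :=
    Integrable.of_bound (by fun_prop) B (Filter.Eventually.of_forall fun x => by simpa using hB x)
  have h2 := integrable_sq μ hF hB
  set t := ∫ x, ‖F x‖ ∂μ
  have h3 : 0 ≤ ∫ x, (‖F x‖ - t) ^ 2 ∂μ := integral_nonneg fun x => sq_nonneg _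
  have h4 : ∫ x, (‖F x‖ - t) ^ 2 ∂μ = ∫ x, (‖F x‖ ^ 2 - 2 * t * ‖F x‖ + t ^ 2) ∂μ := by
    congr 1; funext x; ring
  have h5 : Integrable (fun x => ‖F x‖ ^ 2 - 2 * t * ‖F x‖) μ := h2.sub (h1.const_mul _)
  rw [h4, integral_add h5 (integrable_const _),
    integral_sub h2 (h1.const_mul _), integral_const_mul] at h3
  simp at h3
  nlinarith

lemma Bd.const {ι : Type} [Fintype ι] {g : ι → ℤ → G} (hg : ∀ j, PD 0 (g j)) : Bd 1 g := by
  intro X _ μ _ S hS hmp f hf hb N M hN hM a ha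
  refine Real.sqrt_le_iff.2 ⟨gowersNorm_nonneg _ _ _, ?_⟩
  have : ∀ x, ‖Avg S a f g x‖ ^ 2 ≤ gowersNorm M 1 a ^ 2 := by
    intro x
    refine pow_le_pow_left₀ (norm_nonneg _) ?_ 2
    have : Avg S a f g x = ((∑ k, a k) / (M : ℂ)) * ∏ j, f j (S (g j 0) x) := by
      unfold Avg
      rw [div_mul_eq_mul_div, Finset.sum_mul]
      congr 1
      refine Finset.sum_congr rfl fun k _ => ?_
      congr 1
      exact Finset.prod_congr rfl fun j _ => by rw [hg j _ 0]
    rw [this, norm_mul, gowersNorm]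
    exact mul_le_of_le_one_right (norm_nonneg _) (prod_le hb _)
  calc ∫ x, ‖Avg S a f g x‖ ^ 2 ∂μ ≤ ∫ x, gowersNorm M 1 a ^ 2 ∂μ :=
        integral_mono (integrable_sq μ (Avg_meas (fun u => (hmp u).measurable) a hf g)
          (Avg_bdd S a hb g)) (integrable_const _) this
    _ = _ := by simp

lemma Bd.drop {d : ℕ} {ι : Type} [Fintype ι] {g g' : ι → ℤ → G} (hg' : Bd d g')
    (hg : ∀ j, PD 0 (g j) ∨ g j = g' j) : Bd d g := by
  classical
  intro X _ μ _ S hS hmp f hf hb N M hN hM a ha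
  let f' : ι → X → ℂ := fun j => if PD 0 (g j) then fun _ => 1 else f j
  have hf' : ∀ j, Measurable (f' j) := by
    intro j; simp only [f']; split_ifs
    · exact measurable_const
    · exact hf j
  have hb' : ∀ j x, ‖f' j x‖ ≤ 1 := by
    intro j x; simp only [f']; split_ifs
    · simp
    · exact hb j x
  refine le_trans ?_ (hg' X μ S hS hmp f' hf' hb' N M hN hM a ha)
  refine Real.sqrt_le_sqrt ?_
  refine integral_mono (integrable_sq μ (Avg_meas (fun u => (hmp u).measurable) a hf g)
          (Avg_bdd S a hb g)) (integrable_sq μ (Avg_meas (fun u => (hmp u).measurable) a hf' g')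
          (Avg_bdd S a hb' g')) fun x => ?_
  refine pow_le_pow_left₀ (norm_nonneg _) ?_ 2
  let f'' : ι → X → ℂ := fun j => if PD 0 (g j) then f j else fun _ => 1
  have hb'' : ∀ j x, ‖f'' j x‖ ≤ 1 := by
    intro j x; simp only [f'']; split_ifs
    · exact hb j x
    · simp
  have : Avg S a f g x = Avg S a f' g' x * ∏ j, f'' j (S (g j 0) x) := by
    unfold Avg
    rw [div_mul_eq_mul_div, Finset.sum_mul]
    congr 1
    refine Finset.sum_congr rfl fun k _ => ?_
    rw [mul_assoc, ← Finset.prod_mul_distrib]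
    congr 1
    refine Finset.prod_congr rfl fun j _ => ?_
    by_cases h : PD 0 (g j)
    · simp only [f', f'', if_pos h, one_mul]; rw [h _ 0]
    · simp only [f', f'', if_neg h, mul_one]; rw [(hg j).resolve_left h]
  rw [this, norm_mul]
  exact mul_le_of_le_one_right (norm_nonneg _) (prod_le hb'' _)

def fam {ι : Type} (g : ι → ℤ → G) (c : ℤ → G) (h : ℤ) : ι ⊕ ι → ℤ → G :=
  Sum.elim (fun j n => g j (n + h) - c n) (fun j n => g j n - c n)

lemma step_key {ι : Type} [Fintype ι] (g : ι → ℤ → G) (c : ℤ → G)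
    {X : Type} [MeasurableSpace X] (μ : Measure X) [IsProbabilityMeasure μ] (S : G → X → X)
    (hS : ∀ u v x, S (u + v) x = S u (S v x)) (hmp : ∀ u, MeasurePreserving (S u) μ μ)
    (f : ι → X → ℂ) (hf : ∀ j, Measurable (f j)) (hb : ∀ j x, ‖f j x‖ ≤ 1)
    (N M : ℕ) (hN : 2 * N ≤ M) (hM : 0 < M) (a : Fin M → ℂ)
    (ha : ∀ k : Fin M, N ≤ (k : ℕ) → a k = 0)
    (f2 : ι ⊕ ι → X → ℂ) (hf2 : f2 = Sum.elim f (fun j x => (starRingEnd ℂ) (f j x)))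
    (lift : Fin M → ℤ) (hl : lift = fun h : Fin M => if (h : ℕ) < N then ((h : ℕ) : ℤ) else (h : ℕ) - (M : ℤ)) :
    AA μ S a f g ^ 2 ≤ (∑ h : Fin M, AA μ S (fun n => a (n + h) * (starRingEnd ℂ) (a n)) f2
      (fam g c (lift h))) / M := by
  have : NeZero M := ⟨hM.ne'⟩
  have hMc : (M : ℂ) ≠ 0 := by exact_mod_cast hM.ne'
  have hSm : ∀ u, Measurable (S u) := fun u => (hmp u).measurable
  have hm2 : ∀ j, Measurable (f2 j) := by
    subst hf2; rintro (j | j)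
    · exact hf j
    · exact Complex.continuous_conj.measurable.comp (hf j)
  have hb2 : ∀ j x, ‖f2 j x‖ ≤ 1 := by
    subst hf2; rintro (j | j) x
    · exact hb j x
    · simpa using hb j x
  let v : Fin M → X → ℂ := fun k x => ∏ j, f j (S (g j ((k : ℕ) : ℤ)) x)
  have hv : ∀ k, Measurable (v k) := fun k =>
    Finset.measurable_prod _ fun j _ => (hf j).comp (hSm _)
  have hvb : ∀ k x, ‖v k x‖ ≤ 1 := fun k x => prod_le hb _
  have hvi : ∀ k l, Integrable (fun x => v k x * (starRingEnd ℂ) (v l x)) μ := by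
    intro k l
    refine Integrable.of_bound ((hv k).mul
      (Complex.continuous_conj.measurable.comp (hv l))).aestronglyMeasurable 1
      (Filter.Eventually.of_forall fun x => ?_)
    rw [norm_mul, RCLike.norm_conj]
    exact mul_le_one₀ (hvb k x) (norm_nonneg _) (hvb l x)
  let u : Fin M → Fin M → X → ℂ := fun h k x => ∏ j, f2 j (S (fam g c (lift h) j ((k : ℕ) : ℤ)) x)
  have hu : ∀ h k, Measurable (u h k) := fun h k =>
    Finset.measurable_prod _ fun j _ => (hm2 j).comp (hSm _)
  have hui : ∀ h k, Integrable (u h k) μ := fun h k =>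
    Integrable.of_bound (hu h k).aestronglyMeasurable 1
      (Filter.Eventually.of_forall fun x => prod_le hb2 _)
  have key : ∀ h k : Fin M, a (k + h) * (starRingEnd ℂ) (a k) *
      ∫ x, v (k + h) x * (starRingEnd ℂ) (v k x) ∂μ =
      a (k + h) * (starRingEnd ℂ) (a k) * ∫ x, u h k x ∂μ := by
    intro h k
    by_cases h1 : N ≤ (k : ℕ)
    · simp [ha k h1]
    by_cases h2 : N ≤ ((k + h : Fin M) : ℕ)
    · simp [ha _ h2]
    have h3 : (((k + h : Fin M) : ℕ) : ℤ) = (k : ℕ) + lift h := by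
      have e := Fin.val_add k h
      have hk := k.isLt
      have hh := h.isLt
      subst hl
      push Not at h1 h2
      rcases lt_or_ge ((k : ℕ) + h) M with h4 | h4
      · rw [Nat.mod_eq_of_lt h4] at e
        have : (h : ℕ) < N := by omega
        simp only [if_pos this]; omega
      · rw [Nat.mod_eq_sub_mod h4, Nat.mod_eq_of_lt (by omega)] at e
        have : ¬ (h : ℕ) < N := by omega
        simp only [if_neg this]; omega
    congr 1
    have h5 : ∀ x, v (k + h) x * (starRingEnd ℂ) (v k x) = u h k (S (c ((k : ℕ) : ℤ)) x) := by
      intro x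
      simp only [v, u, fam, hf2, Fintype.prod_sum_type, Sum.elim_inl, Sum.elim_inr, ← hS,
        sub_add_cancel, map_prod, h3]
    simp_rw [h5]
    have := integral_map (μ := μ) (hmp (c ((k : ℕ) : ℤ))).aemeasurable
      (f := u h k) (hu h k).aestronglyMeasurable
    rw [(hmp _).map_eq] at this
    exact this.symm
  have e1 : AA μ S a f g ^ 2 = ∫ x, ‖Avg S a f g x‖ ^ 2 ∂μ :=
    Real.sq_sqrt (integral_nonneg fun x => by positivity)
  have e2 : ((AA μ S a f g ^ 2 : ℝ) : ℂ) = (∑ h : Fin M, ∫ x,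
      Avg S (fun n => a (n + h) * (starRingEnd ℂ) (a n)) f2 (fam g c (lift h)) x ∂μ) / M := by
    rw [e1, ← integral_complex_ofReal]
    have e3 : ∀ x, ((‖Avg S a f g x‖ ^ 2 : ℝ) : ℂ) = ∑ h : Fin M, ∑ k : Fin M,
        (a (k + h) * (starRingEnd ℂ) (a k) / (M : ℂ) ^ 2) * (v (k + h) x * (starRingEnd ℂ) (v k x)) := by
      intro x
      have : Avg S a f g x = (∑ k, a k * v k x) / M := rfl
      rw [this]
      push_cast
      rw [← Complex.mul_conj']
      simp only [map_div₀, map_sum, map_mul, Complex.conj_natCast]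
      rw [div_mul_div_comm, Finset.sum_mul_sum, Finset.sum_comm, Finset.sum_comm (γ := Fin M), ← sq,
        Finset.sum_comm, Finset.sum_div, Finset.sum_comm (γ := Fin M)]
      refine Finset.sum_congr rfl fun k _ => ?_
      rw [← Equiv.sum_comp (Equiv.addLeft k), Finset.sum_div]
      refine Finset.sum_congr rfl fun h _ => ?_
      simp only [Equiv.coe_addLeft]
      ring
    simp_rw [e3]
    rw [integral_finsetSum _ fun h _ => integrable_finsetSum _ fun k _ => (hvi _ _).const_mul _,
      Finset.sum_div]
    refine Finset.sum_congr rfl fun h _ => ?_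
    rw [integral_finsetSum _ fun k _ => (hvi _ _).const_mul _]
    have e4 : ∀ x, Avg S (fun n => a (n + h) * (starRingEnd ℂ) (a n)) f2 (fam g c (lift h)) x =
      (∑ k, (a (k + h) * (starRingEnd ℂ) (a k)) * u h k x) / M := fun x => rfl
    simp_rw [e4]
    rw [integral_div, integral_finsetSum _ fun k _ => (hui _ _).const_mul _, Finset.sum_div,
      Finset.sum_div]
    refine Finset.sum_congr rfl fun k _ => ?_
    rw [integral_const_mul, integral_const_mul, ← key h k]
    field_simp
  have e5 : AA μ S a f g ^ 2 = ‖((AA μ S a f g ^ 2 : ℝ) : ℂ)‖ := by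
    rw [Complex.norm_real, Real.norm_of_nonneg (by positivity)]
  rw [e5, e2, norm_div, Complex.norm_natCast]
  gcongr
  refine (norm_sum_le _ _).trans (Finset.sum_le_sum fun h _ => ?_)
  exact norm_integral_le_sqrt μ (Avg_meas hSm _ hm2 _) (Avg_bdd S _ hb2 _)

lemma Bd.step {d : ℕ} {ι : Type} [Fintype ι] {g : ι → ℤ → G} (c : ℤ → G) (hd : 1 ≤ d)
    (H : ∀ h, Bd d (fam g c h)) : Bd (d + 1) g := by
  obtain ⟨e, rfl⟩ : ∃ e, d = e + 1 := ⟨d - 1, by omega⟩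
  intro X _ μ _ S hS hmp f hf hb N M hN hM a ha
  set f2 : ι ⊕ ι → X → ℂ := Sum.elim f (fun j x => (starRingEnd ℂ) (f j x)) with hf2
  set lift : Fin M → ℤ := fun h => if (h : ℕ) < N then ((h : ℕ) : ℤ) else (h : ℕ) - (M : ℤ) with hl
  have hm2 : ∀ j, Measurable (f2 j) := by
    rintro (j | j)
    · exact hf j
    · exact Complex.continuous_conj.measurable.comp (hf j)
  have hb2 : ∀ j x, ‖f2 j x‖ ≤ 1 := by
    rintro (j | j) x
    · exact hb j x
    · simpa [hf2] using hb j x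
  have key := step_key g c μ S hS hmp f hf hb N M hN hM a ha f2 hf2 lift hl
  have hMr : (M : ℝ) ≠ 0 := by exact_mod_cast hM.ne'
  have hA0 : ∀ h : Fin M, 0 ≤ AA μ S (fun n => a (n + h) * (starRingEnd ℂ) (a n)) f2
      (fam g c (lift h)) := fun h => Real.sqrt_nonneg _
  refine le_of_pow_le_pow_left₀ (n := 2 ^ (e + 2)) (by positivity) (gowersNorm_nonneg _ _ _) ?_
  rw [gowersNorm_pow]
  calc AA μ S a f g ^ 2 ^ (e + 2) = (AA μ S a f g ^ 2) ^ 2 ^ (e + 1) := by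
        rw [← pow_mul]; congr 1; ring
    _ ≤ ((∑ h : Fin M, AA μ S (fun n => a (n + h) * (starRingEnd ℂ) (a n)) f2
          (fam g c (lift h))) / M) ^ 2 ^ (e + 1) := pow_le_pow_left₀ (sq_nonneg _) key _
    _ ≤ (∑ h : Fin M, (AA μ S (fun n => a (n + h) * (starRingEnd ℂ) (a n)) f2
          (fam g c (lift h))) ^ 2 ^ (e + 1)) / M := by
        have := Real.pow_arith_mean_le_arith_mean_pow Finset.univ (fun _ : Fin M => (M : ℝ)⁻¹)
          (fun h => AA μ S (fun n => a (n + h) * (starRingEnd ℂ) (a n)) f2 (fam g c (lift h)))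
          (fun _ _ => by positivity) (by simp [hMr]) (fun h _ => hA0 h) (2 ^ (e + 1))
        simpa [← Finset.mul_sum, div_eq_inv_mul] using this
    _ ≤ _ := by
        gcongr with h _
        · exact hA0 h
        · refine H (lift h) X μ S hS hmp f2 hm2 hb2 N M hN hM _ fun k hk => ?_
          simp [ha k hk]

def TT (G : Type) [AddCommGroup G] (ks : List ℕ) : Prop :=
  ∀ (ι : Type) [Fintype ι], ∃ d, 2 ≤ d ∧ ∀ (g : ι → ℤ → G) (D : List ((ℤ → G) × ℕ)),
    D.map Prod.snd = ks → ks.Pairwise (· ≤ ·) → (∀ p ∈ D, PD (p.2 + 1) p.1) →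
    (∀ j, PD 0 (g j) ∨ ∃ p ∈ D, PD p.2 (fun n => g j n - p.1 n)) → Bd d g

lemma TT.nil : TT G [] := by
  intro ι _
  refine ⟨2, le_rfl, fun g D hD _ _ hg => ?_⟩
  have hD : D = [] := by simpa using hD
  subst hD
  have hg : ∀ j, PD 0 (g j) := fun j => by simpa using hg j
  refine Bd.step (fun _ => 0) le_rfl fun h => Bd.const ?_
  rintro (j | j)
  · exact ((hg j).shift h).sub (PD.zero 0)
  · exact (hg j).sub (PD.zero 0)

/-- common reduction -/
lemma TT.red {d : ℕ} (hd : 2 ≤ d) {ι : Type} [Fintype ι] (g : ι → ℤ → G) (c : ℤ → G) (k : ℕ)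
    (D : List ((ℤ → G) × ℕ)) (hc : PD (k + 1) c) (hk : ∀ p ∈ D, k ≤ p.2)
    (hD : ∀ p ∈ D, PD (p.2 + 1) p.1)
    (hg : ∀ j, PD 0 (g j) ∨ ∃ p ∈ (c, k) :: D, PD p.2 (fun n => g j n - p.1 n))
    (H : ∀ g2 : ι ⊕ ι → ℤ → G, (∀ j, PD k (g2 j) ∨
      ∃ p ∈ D.map (fun p => ((fun n => p.1 n - c n), p.2)), PD p.2 (fun n => g2 j n - p.1 n)) →
      (∀ p ∈ D.map (fun p => ((fun n => p.1 n - c n), p.2)), PD (p.2 + 1) p.1) →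
      Bd d g2) : Bd (d + 1) g := by
  classical
  let g' : ι → ℤ → G := fun j => if PD 0 (g j) then c else g j
  have hg' : ∀ j, ∃ p ∈ (c, k) :: D, PD p.2 (fun n => g' j n - p.1 n) := by
    intro j
    by_cases h : PD 0 (g j)
    · refine ⟨(c, k), by simp, ?_⟩
      simp only [g', if_pos h, sub_self]
      exact PD.zero k
    · simp only [g', if_neg h]
      exact (hg j).resolve_left h
  refine Bd.drop (g' := g') ?_ ?_
  · refine Bd.step c (by omega) fun h => H _ ?_ ?_
    · rintro (j | j)
      · obtain ⟨p, hp, hpj⟩ := hg' j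
        rcases List.mem_cons.1 hp with rfl | hp
        · exact Or.inl (PD.cover hpj hc h)
        · refine Or.inr ⟨_, List.mem_map_of_mem hp, ?_⟩
          have := PD.cover hpj (hD p hp) h
          simpa [fam] using this
      · obtain ⟨p, hp, hpj⟩ := hg' j
        rcases List.mem_cons.1 hp with rfl | hp
        · exact Or.inl hpj
        · refine Or.inr ⟨_, List.mem_map_of_mem hp, ?_⟩
          simpa [fam] using hpj
    · intro p hp
      obtain ⟨p, hp', rfl⟩ := List.mem_map.1 hp
      exact (hD p hp').sub (hc.mono (by have := hk p hp'; omega))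
  · intro j
    by_cases h : PD 0 (g j)
    · exact Or.inl h
    · right; simp only [g', if_neg h]

lemma TT.cons (k : ℕ) : ∀ ks : List ℕ, TT G ks → TT G (k :: ks) := by
  classical
  induction k with
  | zero =>
    intro ks hks ι _
    obtain ⟨d, hd, H⟩ := hks (ι ⊕ ι)
    refine ⟨d + 1, by omega, fun g D hDk hs hD hg => ?_⟩
    obtain _ | ⟨⟨c, k'⟩, D⟩ := D
    · simp at hDk
    simp only [List.map_cons, List.cons.injEq] at hDk
    obtain ⟨rfl, hDk⟩ := hDk
    refine TT.red hd g c 0 D (hD _ List.mem_cons_self) (fun p _ => Nat.zero_le _)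
      (fun p hp => hD p (List.mem_cons_of_mem _ hp)) hg fun g2 hg2 hD2 => ?_
    exact H g2 _ (by simpa [Function.comp_def] using hDk) hs.of_cons hD2 hg2
  | succ k ih =>
    intro ks hks ι _
    have hrep : ∀ n, TT G (List.replicate n k ++ ks) := by
      intro n
      induction n with
      | zero => simpa using hks
      | succ n ihn => rw [List.replicate_succ, List.cons_append]; exact ih _ ihn
    obtain ⟨d, hd, H⟩ := hrep (Fintype.card (ι ⊕ ι)) (ι ⊕ ι)
    refine ⟨d + 1, by omega, fun g D hDk hs hD hg => ?_⟩
    obtain _ | ⟨⟨c, k'⟩, D⟩ := D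
    · simp at hDk
    simp only [List.map_cons, List.cons.injEq] at hDk
    obtain ⟨rfl, hDk⟩ := hDk
    have hle : ∀ k' ∈ ks, k + 1 ≤ k' := (List.pairwise_cons.1 hs).1
    refine TT.red hd g c (k + 1) D (hD _ List.mem_cons_self) (fun p hp => hle _ ?_)
      (fun p hp => hD p (List.mem_cons_of_mem _ hp)) hg fun g2 hg2 hD2 => ?_
    · rw [← hDk]; exact List.mem_map_of_mem hp
    refine H g2 ((Finset.univ.toList.map fun j : ι ⊕ ι =>
        ((if PD (k + 1) (g2 j) then g2 j else fun _ => 0), k)) ++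
        D.map (fun p => ((fun n => p.1 n - c n), p.2))) ?_ ?_ ?_ ?_
    · rw [List.map_append]
      congr 1
      · rw [List.map_map]
        simp [List.eq_replicate_iff]
      · simpa [Function.comp_def] using hDk
    · rw [List.pairwise_append]
      refine ⟨by simp [List.pairwise_replicate], hs.of_cons, fun x hx y hy => ?_⟩
      have := hle y hy
      have := List.eq_of_mem_replicate hx
      omega
    · intro p hp
      rcases List.mem_append.1 hp with hp | hp
      · obtain ⟨j, -, rfl⟩ := List.mem_map.1 hp
        by_cases h : PD (k + 1) (g2 j)
        · simpa only [if_pos h] using h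
        · simpa only [if_neg h] using PD.zero (k + 1)
      · exact hD2 p hp
    · intro j
      right
      rcases hg2 j with h | ⟨p, hp, h⟩
      · refine ⟨_, List.mem_append_left _ (List.mem_map_of_mem (a := j) (by simp)), ?_⟩
        simp only [if_pos h, sub_self]
        exact PD.zero k
      · exact ⟨p, List.mem_append_right _ hp, h⟩

end main

lemma exists_bd (G : Type) [AddCommGroup G] (m s : ℕ) : ∃ d, 2 ≤ d ∧ ∀ g : Fin m → ℤ → G,
    (∀ j, PD s (g j)) → Bd d g := by
  have h : ∀ n, TT G (List.replicate n s) := by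
    intro n
    induction n with
    | zero => exact TT.nil
    | succ n ih => rw [List.replicate_succ]; exact TT.cons s _ ih
  obtain ⟨d, hd, H⟩ := h m (Fin m)
  refine ⟨d, hd, fun g hg => H g (List.ofFn fun j => (g j, s)) ?_ ?_ ?_ ?_⟩
  · rw [List.map_ofFn, List.eq_replicate_iff]
    simp
  · simp [List.pairwise_replicate]
  · intro p hp
    obtain ⟨j, rfl⟩ := (List.mem_ofFn' _ _).1 hp
    exact (hg j).succ
  · intro j
    refine Or.inr ⟨(g j, s), (List.mem_ofFn' _ _).2 ⟨j, rfl⟩, ?_⟩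
    simpa using PD.zero s

lemma prodPow_add {X : Type} {ℓ : ℕ} (T : Fin ℓ → Equiv.Perm X)
    (hT : ∀ i i', Commute (T i) (T i')) (u v : Fin ℓ → ℤ) :
    prodPow T (u + v) = prodPow T u * prodPow T v := by
  induction ℓ with
  | zero => simp [prodPow]
  | succ ℓ ih =>
    have := ih (fun i => T i.succ) (fun i i' => hT _ _) (fun i => u i.succ) (fun i => v i.succ)
    simp only [prodPow, List.ofFn_succ, List.prod_cons, Pi.add_apply] at this ⊢
    rw [this, zpow_add]
    have hc : Commute (T 0 ^ v 0) (List.ofFn fun i : Fin ℓ => T i.succ ^ u i.succ).prod := by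
      apply Commute.list_prod_right
      intro x hx
      obtain ⟨i, rfl⟩ := (List.mem_ofFn' _ _).1 hx
      exact (hT _ _).zpow_zpow _ _
    have hc := hc.eq
    rw [mul_assoc, ← mul_assoc (T 0 ^ v 0), hc]
    simp only [mul_assoc]

lemma mp_zpow {X : Type} [MeasurableSpace X] {μ : Measure X} {T : Equiv.Perm X}
    (h1 : MeasurePreserving T μ μ) (h2 : MeasurePreserving T.symm μ μ) (n : ℤ) :
    MeasurePreserving (T ^ n : Equiv.Perm X) μ μ := by
  have hn : ∀ (R : Equiv.Perm X), MeasurePreserving R μ μ → ∀ n : ℕ,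
      MeasurePreserving (R ^ n : Equiv.Perm X) μ μ := by
    intro R hR n
    rw [Equiv.Perm.coe_pow]
    exact hR.iterate n
  obtain ⟨n, rfl | rfl⟩ := n.eq_nat_or_neg
  · rw [zpow_natCast]; exact hn T h1 n
  · rw [zpow_neg, zpow_natCast, ← inv_pow]; exact hn T⁻¹ h2 n

lemma mp_prodPow {X : Type} [MeasurableSpace X] {μ : Measure X} {ℓ : ℕ} (T : Fin ℓ → Equiv.Perm X)
    (h1 : ∀ i, MeasurePreserving (T i) μ μ) (h2 : ∀ i, MeasurePreserving (T i).symm μ μ)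
    (u : Fin ℓ → ℤ) : MeasurePreserving (prodPow T u) μ μ := by
  induction ℓ with
  | zero => simpa [prodPow] using MeasurePreserving.id μ
  | succ ℓ ih =>
    have := ih (fun i => T i.succ) (fun i => h1 _) (fun i => h2 _) (fun i => u i.succ)
    simp only [prodPow, List.ofFn_succ, List.prod_cons] at this ⊢
    exact (mp_zpow (h1 0) (h2 0) _).comp this

end GW
/-- Gowers norm control of weighted polynomial multiple ergodic averages: there are `d`
(depending only on `ℓ`, `m` and the maximal degree `s` of the polynomials) and `C > 0`
(depending only on `d`) such that for every sequence `a` with `a(n)/n^c → 0` for all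
`c > 0` and every `ε > 0` there is `N₀` (depending only on `d`, `a`, `ε`) so that for all
`N ≥ N₀`, all probability spaces, all commuting invertible measure preserving
`T₁, …, T_ℓ`, all polynomials `q_{i,j}` of degree at most `s` and all functions bounded
by `1`,
`‖(1/N) ∑_{n=1}^N a(n)·(∏ᵢ Tᵢ^{q_{i,1}(n)})f₁ ⋯ (∏ᵢ Tᵢ^{q_{i,m}(n)})fₘ‖_{L²(μ)}
  ≤ C·‖a·1_{[1,N]}‖_{U_d(ℤ_{dN})} + ε`,
where `a·1_{[1,N]}` is viewed on `ℤ_{dN}` by identifying `ℤ_{dN}` with `{1, …, dN}`. -/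
theorem gowers_controls_weighted_averages (ℓ m s : ℕ) :
    ∃ d : ℕ, ∃ C : ℝ, 0 < C ∧
      ∀ a : ℕ → ℂ,
        (∀ c : ℝ, 0 < c →
          Filter.Tendsto (fun n : ℕ => a n / ((n : ℂ) ^ (c : ℂ))) Filter.atTop (nhds 0)) →
        ∀ ε : ℝ, 0 < ε → ∃ N₀ : ℕ, ∀ N : ℕ, N₀ ≤ N →
          ∀ (X : Type) [MeasurableSpace X] (μ : Measure X) [IsProbabilityMeasure μ]
            (T : Fin ℓ → Equiv.Perm X),
            (∀ i, MeasurePreserving (T i) μ μ) →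
            (∀ i, MeasurePreserving (T i).symm μ μ) →
            (∀ i i', Commute (T i) (T i')) →
            ∀ q : Fin ℓ → Fin m → Polynomial ℤ,
              (∀ i j, (q i j).natDegree ≤ s) →
              ∀ f : Fin m → X → ℂ,
                (∀ j, Measurable (f j)) → (∀ j, ∀ᵐ x ∂μ, ‖f j x‖ ≤ 1) →
                (eLpNorm (fun x => (N : ℂ)⁻¹ * ∑ n ∈ Finset.Icc 1 N,
                    a n * ∏ j : Fin m,
                      f j (prodPow T (fun i => (q i j).eval (n : ℤ)) x)) 2 μ).toReal ≤
                  C * gowersNorm (d * N) d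
                      (fun k => if (k : ℕ) + 1 ≤ N then a ((k : ℕ) + 1) else 0) + ε := by
  obtain ⟨d, hd, H⟩ := GW.exists_bd (Fin ℓ → ℤ) m s
  have hd0 : (0 : ℝ) < d := by exact_mod_cast (by omega : 0 < d)
  refine ⟨d, d, hd0, fun a _ ε hε => ⟨1, ?_⟩⟩
  intro N hN X _ μ _ T h1 h2 hT q hq f hf hb
  classical
  set a' : Fin (d * N) → ℂ := fun k => if (k : ℕ) + 1 ≤ N then a ((k : ℕ) + 1) else 0 with ha'
  let g : Fin m → ℤ → Fin ℓ → ℤ := fun j n i => (q i j).eval (n + 1)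
  have hg : ∀ j, GW.PD s (g j) := fun j => GW.PD.pi fun i =>
    (GW.PD.poly (hq i j)).shift 1
  let f' : Fin m → X → ℂ := fun j x => if ‖f j x‖ ≤ 1 then f j x else 0
  have hf' : ∀ j, Measurable (f' j) := fun j =>
    Measurable.ite (measurableSet_le (hf j).norm measurable_const) (hf j) measurable_const
  have hb' : ∀ j x, ‖f' j x‖ ≤ 1 := by
    intro j x; simp only [f']; split_ifs with h
    · exact h
    · simp
  have hmp := GW.mp_prodPow T h1 h2
  have key := H g hg X μ (fun u => prodPow T u)
    (fun u v x => by rw [GW.prodPow_add T hT]; rfl) hmp f' hf' hb' N (d * N)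
    (Nat.mul_le_mul_right _ hd) (Nat.mul_pos (by omega) hN) a'
    (fun k hk => by simp only [ha']; rw [if_neg (by omega)])
  have hff : ∀ᵐ x ∂μ, ∀ j : Fin m, ∀ n ∈ Finset.Icc 1 N,
      f j (prodPow T (fun i => (q i j).eval (n : ℤ)) x) =
      f' j (prodPow T (fun i => (q i j).eval (n : ℤ)) x) := by
    rw [ae_all_iff]; intro j
    rw [Filter.eventually_all_finset]
    intro n _
    have := (hmp (fun i => (q i j).eval (n : ℤ))).quasiMeasurePreserving.ae (hb j)
    filter_upwards [this] with x hx
    simp only [f', if_pos hx]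
  have hNc : (N : ℂ) ≠ 0 := by exact_mod_cast (by omega : N ≠ 0)
  have hdc : (d : ℂ) ≠ 0 := by exact_mod_cast (by omega : d ≠ 0)
  have hae : (fun x => (N : ℂ)⁻¹ * ∑ n ∈ Finset.Icc 1 N,
      a n * ∏ j : Fin m, f j (prodPow T (fun i => (q i j).eval (n : ℤ)) x)) =ᵐ[μ]
      (d : ℂ) • GW.Avg (fun u => prodPow T u) a' f' g := by
    filter_upwards [hff] with x hx
    have e1 : ∑ n ∈ Finset.Icc 1 N, a n *
        ∏ j : Fin m, f j (prodPow T (fun i => (q i j).eval (n : ℤ)) x) =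
        ∑ k : Fin (d * N), a' k * ∏ j, f' j (prodPow T (g j ((k : ℕ) : ℤ)) x) := by
      let φ : ℕ → ℂ := fun k => (if k + 1 ≤ N then a (k + 1) else 0) *
        ∏ j, f' j (prodPow T (g j (k : ℤ)) x)
      have e2 : ∑ k : Fin (d * N), a' k * ∏ j, f' j (prodPow T (g j ((k : ℕ) : ℤ)) x) =
          ∑ k ∈ Finset.range (d * N), φ k := Fin.sum_univ_eq_sum_range φ (d * N)
      rw [e2]
      have e3 : ∑ k ∈ Finset.range N, φ k = ∑ k ∈ Finset.range (d * N), φ k := by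
        refine Finset.sum_subset ?_ ?_
        · exact Finset.range_subset_range.2 (Nat.le_mul_of_pos_left N (by omega))
        · intro k _ hk
          have : ¬ k + 1 ≤ N := by simpa using hk
          simp only [φ, if_neg this, zero_mul]
      rw [← e3, Finset.range_eq_Ico, ← Finset.sum_Ico_add_right_sub_eq (c := 1)]
      refine Finset.sum_congr (by ext; simp) fun n hn => ?_
      have hn' := Finset.mem_Icc.1 hn
      obtain ⟨k, rfl⟩ : ∃ k, n = k + 1 := ⟨n - 1, by omega⟩
      simp only [φ, Nat.add_sub_cancel, if_pos hn'.2]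
      congr 1
      refine Finset.prod_congr rfl fun j _ => ?_
      rw [hx j _ hn]
      simp [g]
    rw [e1]
    simp only [Pi.smul_apply, GW.Avg, smul_eq_mul]
    push_cast
    field_simp
  rw [eLpNorm_congr_ae hae, eLpNorm_const_smul, ENNReal.toReal_mul]
  have hm := GW.Avg_meas (fun u => (hmp u).measurable) a' hf' g
  have hL : MemLp (GW.Avg (fun u => prodPow T u) a' f' g) 2 μ :=
    MemLp.of_bound hm.aestronglyMeasurable _
      (Filter.Eventually.of_forall (GW.Avg_bdd _ a' hb' g))
  rw [hL.eLpNorm_eq_integral_rpow_norm (by simp) (by simp), ENNReal.toReal_ofReal (by positivity)]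
  have e4 : (∫ x, ‖GW.Avg (fun u => prodPow T u) a' f' g x‖ ^ (2 : ENNReal).toReal ∂μ) ^
      ((2 : ENNReal).toReal)⁻¹ = GW.AA μ (fun u => prodPow T u) a' f' g := by
    rw [GW.AA, Real.sqrt_eq_rpow]
    simp
  rw [e4]
  have e5 : (‖(d : ℂ)‖ₑ).toReal = d := by simp
  rw [e5]
  have := mul_le_mul_of_nonneg_left key hd0.le
  linarith
end
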